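/- arXiv:1808.08365 — 2 statements merged into one kernel-verified Lean document; each statement's English description precedes it below -/
import Mathlib

section
/- Let n ≥ 2 be an integer and α ∈ [0,1). Let V0, V1 : [0,1) → ℝ be real-valued functions such that V0, V1 ∈ C([0,1)) ∩ C^n((0,1)); x^α V0'(x) and y^α V1'(y) extend continuously to [0,1); and V0(0) = V1(0) = 0. Then there exists a unique C^n-solution V of the Goursat problem for the Euler–Darboux equation in D with data {V0, V1}. -/
open Complex Set MeasureTheory Topology Filter ComplexConjugate

noncomputable section

/-- The triangle `D = {(x,y) : 0 ≤ x, 0 ≤ y, x + y < 1}`. -/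
def TriD : Set (ℝ × ℝ) := {p | 0 ≤ p.1 ∧ 0 ≤ p.2 ∧ p.1 + p.2 < 1}

/-- Partial derivative in the first variable. -/
def pdx (f : ℝ → ℝ → ℂ) (x y : ℝ) : ℂ := deriv (fun t => f t y) x

/-- Partial derivative in the second variable. -/
def pdy (f : ℝ → ℝ → ℂ) (x y : ℝ) : ℂ := deriv (fun t => f x t) y

/-- Mixed second partial derivative. -/
def pdxy (f : ℝ → ℝ → ℂ) (x y : ℝ) : ℂ := pdx (fun a b => pdy f a b) x y

/-- Partial derivative in the first variable (real valued). -/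
def pdxR (f : ℝ → ℝ → ℝ) (x y : ℝ) : ℝ := deriv (fun t => f t y) x

/-- Partial derivative in the second variable (real valued). -/
def pdyR (f : ℝ → ℝ → ℝ) (x y : ℝ) : ℝ := deriv (fun t => f x t) y

/-- Mixed second partial derivative (real valued). -/
def pdxyR (f : ℝ → ℝ → ℝ) (x y : ℝ) : ℝ := pdxR (fun a b => pdyR f a b) x y

/-- The hyperbolic Ernst equation at a point. -/
def ErnstEqAt (E : ℝ → ℝ → ℂ) (x y : ℝ) : Prop :=
  (((E x y).re : ℂ)) * (pdxy E x y - (pdx E x y + pdy E x y) / (2 * (1 - x - y))) =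
    pdx E x y * pdy E x y

/-- The Euler–Darboux equation at a point. -/
def EulerDarbouxAt (V : ℝ → ℝ → ℝ) (x y : ℝ) : Prop :=
  pdxyR V x y - (pdxR V x y + pdyR V x y) / (2 * (1 - x - y)) = 0

/-- `λ(x,y,k) = √((k-(1-y))/(k-x))`, principal branch (`Re λ > 0` off the cut). -/
def lam (x y : ℝ) (k : ℂ) : ℂ := ((k - (1 - (y : ℂ))) / (k - (x : ℂ))) ^ (1/2 : ℂ)

/-- The segment `[0,1]` inside `ℂ`. -/
def seg01 : Set ℂ := (fun t : ℝ => (t : ℂ)) '' Icc 0 1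

/-- A `C^n`-solution of the Goursat problem for the hyperbolic Ernst equation in `D`
with data `{E0, E1}`, with regularity exponent `α`. -/
def ErnstSolutionWith (n : ℕ) (α : ℝ) (E : ℝ → ℝ → ℂ) (E0 E1 : ℝ → ℂ) : Prop :=
  ContinuousOn (fun p : ℝ × ℝ => E p.1 p.2) TriD ∧
  ContDiffOn ℝ n (fun p : ℝ × ℝ => E p.1 p.2) (interior TriD) ∧
  (∀ p ∈ interior TriD, ErnstEqAt E p.1 p.2) ∧
  (∃ g : ℝ × ℝ → ℂ, ContinuousOn g TriD ∧
      ∀ p ∈ interior TriD, g p = ((p.1 ^ α : ℝ) : ℂ) * pdx E p.1 p.2) ∧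
  (∃ g : ℝ × ℝ → ℂ, ContinuousOn g TriD ∧
      ∀ p ∈ interior TriD, g p = ((p.2 ^ α : ℝ) : ℂ) * pdy E p.1 p.2) ∧
  (∃ g : ℝ × ℝ → ℂ, ContinuousOn g TriD ∧
      ∀ p ∈ interior TriD, g p = ((p.1 ^ α * p.2 ^ α : ℝ) : ℂ) * pdxy E p.1 p.2) ∧
  (∀ x ∈ Ico (0:ℝ) 1, E x 0 = E0 x) ∧
  (∀ y ∈ Ico (0:ℝ) 1, E 0 y = E1 y) ∧
  (∀ p ∈ TriD, 0 < (E p.1 p.2).re)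

/-- A `C^n`-solution of the Goursat problem for the hyperbolic Ernst equation in `D`
(with regularity exponent `α` existentially quantified over `[0,1)`). -/
def ErnstSolution (n : ℕ) (E : ℝ → ℝ → ℂ) (E0 E1 : ℝ → ℂ) : Prop :=
  ∃ α ∈ Ico (0:ℝ) 1, ErnstSolutionWith n α E E0 E1

/-- A `C^n`-solution of the Goursat problem for the Euler–Darboux equation in `D`
with data `{V0, V1}`, with regularity exponent `α`. -/
def EDSolutionWith (n : ℕ) (α : ℝ) (V : ℝ → ℝ → ℝ) (V0 V1 : ℝ → ℝ) : Prop :=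
  ContinuousOn (fun p : ℝ × ℝ => V p.1 p.2) TriD ∧
  ContDiffOn ℝ n (fun p : ℝ × ℝ => V p.1 p.2) (interior TriD) ∧
  (∀ p ∈ interior TriD, EulerDarbouxAt V p.1 p.2) ∧
  (∃ g : ℝ × ℝ → ℝ, ContinuousOn g TriD ∧
      ∀ p ∈ interior TriD, g p = p.1 ^ α * pdxR V p.1 p.2) ∧
  (∃ g : ℝ × ℝ → ℝ, ContinuousOn g TriD ∧
      ∀ p ∈ interior TriD, g p = p.2 ^ α * pdyR V p.1 p.2) ∧
  (∃ g : ℝ × ℝ → ℝ, ContinuousOn g TriD ∧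
      ∀ p ∈ interior TriD, g p = p.1 ^ α * p.2 ^ α * pdxyR V p.1 p.2) ∧
  (∀ x ∈ Ico (0:ℝ) 1, V x 0 = V0 x) ∧
  (∀ y ∈ Ico (0:ℝ) 1, V 0 y = V1 y)

/-- A `C^n`-solution of the Goursat problem for the Euler–Darboux equation in `D`. -/
def EDSolution (n : ℕ) (V : ℝ → ℝ → ℝ) (V0 V1 : ℝ → ℝ) : Prop :=
  ∃ α ∈ Ico (0:ℝ) 1, EDSolutionWith n α V V0 V1

/-- The data assumptions (1.5) on a single boundary datum for the Ernst equation. -/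
def ErnstData (n : ℕ) (α : ℝ) (E0 : ℝ → ℂ) : Prop :=
  ContinuousOn E0 (Ico 0 1) ∧ ContDiffOn ℝ n E0 (Ioo 0 1) ∧
  (∃ g : ℝ → ℂ, ContinuousOn g (Ico 0 1) ∧
      ∀ x ∈ Ioo (0:ℝ) 1, g x = ((x ^ α : ℝ) : ℂ) * deriv E0 x) ∧
  E0 0 = 1 ∧ (∀ x ∈ Ico (0:ℝ) 1, 0 < (E0 x).re)

/-- The data assumptions on a single boundary datum for the Euler–Darboux equation. -/
def EDData (n : ℕ) (α : ℝ) (V0 : ℝ → ℝ) : Prop :=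
  ContinuousOn V0 (Ico 0 1) ∧ ContDiffOn ℝ n V0 (Ioo 0 1) ∧
  (∃ g : ℝ → ℝ, ContinuousOn g (Ico 0 1) ∧
      ∀ x ∈ Ioo (0:ℝ) 1, g x = x ^ α * deriv V0 x) ∧
  V0 0 = 0

/-- The matrix `U0(x,k)` of the x-part of the Lax pair, built from the boundary datum. -/
def U0mat (E0 : ℝ → ℂ) (x : ℝ) (k : ℂ) : Matrix (Fin 2) (Fin 2) ℂ :=
  (1 / (2 * ((E0 x).re : ℂ))) •
    !![conj (deriv E0 x), lam x 0 k * conj (deriv E0 x);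
       lam x 0 k * deriv E0 x, deriv E0 x]

/-- The matrix `U(x,y,k)` of the Lax pair. -/
def Umat (E : ℝ → ℝ → ℂ) (k : ℂ) (x y : ℝ) : Matrix (Fin 2) (Fin 2) ℂ :=
  (1 / (2 * ((E x y).re : ℂ))) •
    !![conj (pdx E x y), lam x y k * conj (pdx E x y);
       lam x y k * pdx E x y, pdx E x y]

/-- The matrix `V(x,y,k)` of the Lax pair. -/
def Vmat (E : ℝ → ℝ → ℂ) (k : ℂ) (x y : ℝ) : Matrix (Fin 2) (Fin 2) ℂ :=
  (1 / (2 * ((E x y).re : ℂ))) •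
    !![conj (pdy E x y), (lam x y k)⁻¹ * conj (pdy E x y);
       (lam x y k)⁻¹ * pdy E x y, pdy E x y]

open scoped ContDiff

theorem continuousOn_intervalIntegral_of_continuousOn {X : Type*} [TopologicalSpace X]
    {S : Set X} {h : X → ℝ → ℝ} {a b : ℝ} (hab : a ≤ b)
    (hh : ContinuousOn (fun q : X × ℝ => h q.1 q.2) (S ×ˢ Icc a b)) :
    ContinuousOn (fun p => ∫ u in a..b, h p u) S := by
  rw [continuousOn_iff_continuous_domRestrict]
  have hc : Continuous (Function.uncurry
      fun (p : S) (u : ℝ) => h p (projIcc a b hab u : Icc a b)) := by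
    refine hh.comp_continuous (f := fun q : S × ℝ => ((q.1 : X), (projIcc a b hab q.2 : ℝ)))
      ?_ ?_
    · exact (continuous_subtype_val.comp continuous_fst).prodMk
        (continuous_subtype_val.comp (continuous_projIcc.comp continuous_snd))
    · intro q
      exact ⟨q.1.2, (projIcc a b hab q.2).2⟩
  have := intervalIntegral.continuous_parametric_intervalIntegral_of_continuous'
    (μ := volume) hc a b
  refine this.congr fun p => ?_
  refine intervalIntegral.integral_congr fun u hu => ?_
  rw [uIcc_of_le hab] at hu
  simp [projIcc_of_mem hab hu]

theorem hasFDerivAt_intervalIntegral_of_continuousOn {E : Type*} [NormedAddCommGroup E]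
    [NormedSpace ℝ E] [ProperSpace E] {F : E → ℝ → ℝ} {F' : E → ℝ → E →L[ℝ] ℝ} {U : Set E}
    {a b : ℝ} (hU : IsOpen U) (hab : a ≤ b)
    (hF : ContinuousOn (fun q : E × ℝ => F q.1 q.2) (U ×ˢ Icc a b))
    (hF' : ContinuousOn (fun q : E × ℝ => F' q.1 q.2) (U ×ˢ Icc a b))
    (hd : ∀ x ∈ U, ∀ t ∈ Icc a b, HasFDerivAt (fun x => F x t) (F' x t) x)
    {x₀ : E} (hx₀ : x₀ ∈ U) :
    HasFDerivAt (fun x => ∫ t in a..b, F x t) (∫ t in a..b, F' x₀ t) x₀ := by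
  obtain ⟨ε, hε, hεU⟩ := Metric.nhds_basis_closedBall.mem_iff.1 (hU.mem_nhds hx₀)
  have hK : IsCompact (Metric.closedBall x₀ ε ×ˢ Icc a b) :=
    (isCompact_closedBall _ _).prod isCompact_Icc
  obtain ⟨C, hC⟩ := hK.exists_bound_of_continuousOn (hF'.mono (prod_mono hεU le_rfl))
  have slice : ∀ x ∈ U, ContinuousOn (fun t : ℝ => (x, t)) (Icc a b) ∧
      MapsTo (fun t : ℝ => (x, t)) (Icc a b) (U ×ˢ Icc a b) :=
    fun x hx => ⟨by fun_prop, fun t ht => ⟨hx, ht⟩⟩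
  have hIoc : uIoc a b = Ioc a b := uIoc_of_le hab
  have hFx : ∀ x ∈ U, ContinuousOn (F x) (Icc a b) := fun x hx =>
    hF.comp (slice x hx).1 (slice x hx).2
  refine intervalIntegral.hasFDerivAt_integral_of_dominated_of_fderiv_le
    (s := Metric.closedBall x₀ ε) (bound := fun _ => C)
    (Metric.closedBall_mem_nhds _ hε) ?_ ?_ ?_ ?_ ?_ ?_
  · filter_upwards [hU.mem_nhds hx₀] with x hx
    rw [hIoc]
    exact ((hFx x hx).mono Ioc_subset_Icc_self).aestronglyMeasurable measurableSet_Ioc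
  · exact ContinuousOn.intervalIntegrable (by rw [uIcc_of_le hab]; exact hFx x₀ hx₀)
  · rw [hIoc]
    exact ((hF'.comp (slice x₀ hx₀).1 (slice x₀ hx₀).2).mono
      Ioc_subset_Icc_self).aestronglyMeasurable measurableSet_Ioc
  · refine Eventually.of_forall fun t ht x hx => hC (x, t) ⟨hx, ?_⟩
    rw [hIoc] at ht
    exact Ioc_subset_Icc_self ht
  · exact intervalIntegrable_const
  · refine Eventually.of_forall fun t ht x hx => hd x (hεU hx) t ?_
    rw [hIoc] at ht
    exact Ioc_subset_Icc_self ht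

theorem hasDerivAt_intervalIntegral_of_continuousOn {F F' : ℝ → ℝ → ℝ} {U : Set ℝ}
    {a b : ℝ} (hU : IsOpen U) (hab : a ≤ b)
    (hF : ContinuousOn (fun q : ℝ × ℝ => F q.1 q.2) (U ×ˢ Icc a b))
    (hF' : ContinuousOn (fun q : ℝ × ℝ => F' q.1 q.2) (U ×ˢ Icc a b))
    (hd : ∀ x ∈ U, ∀ t ∈ Icc a b, HasDerivAt (fun x => F x t) (F' x t) x)
    {x₀ : ℝ} (hx₀ : x₀ ∈ U) :
    HasDerivAt (fun x => ∫ t in a..b, F x t) (∫ t in a..b, F' x₀ t) x₀ := by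
  have := hasFDerivAt_intervalIntegral_of_continuousOn
    (F' := fun x t => F' x t • ContinuousLinearMap.id ℝ ℝ) hU hab hF
    (hF'.smul continuousOn_const)
    (fun x hx t ht => by
      refine (hd x hx t ht).hasFDerivAt.congr_fderiv ?_
      ext; simp) hx₀
  rw [intervalIntegral.integral_smul_const] at this
  simpa using this.hasDerivAt

theorem hasFDerivAt_intervalIntegral_endpoint {E : Type*} [NormedAddCommGroup E]
    [NormedSpace ℝ E] {g : E × ℝ → ℝ} (l : E →L[ℝ] ℝ) {p₀ : E}
    (hg : ∀ᶠ q in 𝓝 (p₀, l p₀), ContinuousAt g q) :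
    HasFDerivAt (fun p => ∫ s in l p₀..l p, g (p, s)) (g (p₀, l p₀) • l) p₀ := by
  rw [hasFDerivAt_iff_isLittleO_nhds_zero]
  refine Asymptotics.IsLittleO.trans_isBigO (g := fun h => l h) ?_ (l.isBigO_id _)
  rw [Asymptotics.isLittleO_iff]
  intro c hc
  have hclose : ∀ᶠ q in 𝓝 (p₀, l p₀), dist (g q) (g (p₀, l p₀)) < c :=
    Metric.tendsto_nhds.1 hg.self_of_nhds c hc
  obtain ⟨δ, hδ, hball⟩ := Metric.eventually_nhds_iff.1 (hg.and hclose)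
  have hsmall : ∀ᶠ h in 𝓝 (0 : E), ‖h‖ < δ ∧ ‖l h‖ < δ :=
    (continuous_norm.tendsto' (0 : E) 0 norm_zero |>.eventually_lt_const hδ).and
      ((l.continuous.norm.tendsto' (0 : E) 0 (by simp)).eventually_lt_const hδ)
  filter_upwards [hsmall] with h hh
  have hmem : ∀ s ∈ uIcc (l p₀) (l (p₀ + h)), dist (p₀ + h, s) (p₀, l p₀) < δ := by
    intro s hs
    have hs' := abs_sub_left_of_mem_uIcc hs
    rw [map_add, add_sub_cancel_left] at hs'
    rw [Prod.dist_eq, max_lt_iff]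
    refine ⟨by simpa using hh.1, ?_⟩
    rw [Real.dist_eq]
    exact hs'.trans_lt hh.2
  have hcont : ContinuousOn (fun s => g (p₀ + h, s)) (uIcc (l p₀) (l (p₀ + h))) := by
    intro s hs
    exact ((hball (hmem s hs)).1.comp (f := fun s => (p₀ + h, s))
      (by fun_prop)).continuousWithinAt
  have hsub : (∫ s in l p₀..l (p₀ + h), g (p₀ + h, s)) - (∫ s in l p₀..l p₀, g (p₀, s))
      - (g (p₀, l p₀) • l) h = ∫ s in l p₀..l (p₀ + h), (g (p₀ + h, s) - g (p₀, l p₀)) := by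
    rw [intervalIntegral.integral_sub hcont.intervalIntegrable intervalIntegrable_const]
    simp [mul_comm]
  rw [hsub]
  refine (intervalIntegral.norm_integral_le_of_norm_le_const (C := c) fun s hs => ?_).trans ?_
  · rw [Real.norm_eq_abs, ← Real.dist_eq]
    exact (hball (hmem s (uIoc_subset_uIcc hs))).2.le
  · simp

/-- The integrals `∫₀^π sin²⁽ᵏ⁺¹⁾θ (1 + z sin²θ)^(-3/2-k) dθ`, proportional to the derivatives
of the complete elliptic integral of the first kind. -/
def ellipticMoment (k : ℕ) (z : ℝ) : ℝ :=
  ∫ θ in (0:ℝ)..Real.pi, Real.sin θ ^ (2 * (k + 1)) *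
    (1 + z * Real.sin θ ^ 2) ^ (-(3 / 2 : ℝ) - k)

theorem one_add_mul_sin_sq_pos {z : ℝ} (hz : -1 < z) (θ : ℝ) : 0 < 1 + z * Real.sin θ ^ 2 := by
  rcases (sq_nonneg (Real.sin θ)).eq_or_lt with h | h
  · simp [← h]
  · nlinarith [Real.sin_sq_le_one θ, mul_pos (neg_lt_iff_pos_add.1 hz) h]

theorem continuousOn_ellipticMoment_integrand (k : ℕ) (c r : ℝ) (S : Set ℝ) :
    ContinuousOn (fun q : ℝ × ℝ => c * (Real.sin q.2 ^ k * (1 + q.1 * Real.sin q.2 ^ 2) ^ r))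
      (Ioi (-1) ×ˢ S) := by
  refine continuousOn_const.mul (ContinuousOn.mul (by fun_prop) ?_)
  exact ContinuousOn.rpow_const (by fun_prop)
    fun q hq => Or.inl (one_add_mul_sin_sq_pos hq.1 q.2).ne'

theorem hasDerivAt_ellipticMoment (k : ℕ) {z : ℝ} (hz : -1 < z) :
    HasDerivAt (ellipticMoment k) ((-(3 / 2 : ℝ) - k) * ellipticMoment (k + 1) z) z := by
  have h := hasDerivAt_intervalIntegral_of_continuousOn
    (F := fun z θ => Real.sin θ ^ (2 * (k + 1)) *
      (1 + z * Real.sin θ ^ 2) ^ (-(3 / 2 : ℝ) - k))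
    (F' := fun z θ => (-(3 / 2 : ℝ) - k) * (Real.sin θ ^ (2 * (k + 1 + 1)) *
      (1 + z * Real.sin θ ^ 2) ^ (-(3 / 2 : ℝ) - (k + 1 : ℕ))))
    isOpen_Ioi Real.pi_pos.le
    (by simpa using continuousOn_ellipticMoment_integrand (2 * (k + 1)) 1 _ _)
    (continuousOn_ellipticMoment_integrand _ _ _ _)
    (fun x hx t _ => by
      have h1 : HasDerivAt (fun x : ℝ => 1 + x * Real.sin t ^ 2) (Real.sin t ^ 2) x := by
        simpa using ((hasDerivAt_id x).mul_const (Real.sin t ^ 2)).const_add 1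
      have h2 := (h1.rpow_const (p := -(3 / 2 : ℝ) - k)
        (Or.inl (one_add_mul_sin_sq_pos hx t).ne')).const_mul (Real.sin t ^ (2 * (k + 1)))
      refine h2.congr_deriv ?_
      rw [show (-(3 / 2 : ℝ) - (k + 1 : ℕ)) = -(3 / 2 : ℝ) - k - 1 by push_cast; ring]
      ring) (x₀ := z) hz
  rwa [intervalIntegral.integral_const_mul] at h

theorem contDiffOn_ellipticMoment (m : ℕ) (k : ℕ) :
    ContDiffOn ℝ m (ellipticMoment k) (Ioi (-1)) := by
  induction m generalizing k with
  | zero =>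
    exact contDiffOn_zero.2 fun z hz =>
      (hasDerivAt_ellipticMoment k hz).continuousAt.continuousWithinAt
  | succ m ih =>
    rw [Nat.cast_succ, contDiffOn_succ_iff_deriv_of_isOpen isOpen_Ioi]
    refine ⟨fun z hz =>
      (hasDerivAt_ellipticMoment k hz).differentiableAt.differentiableWithinAt, by simp, ?_⟩
    exact (contDiffOn_const.mul (ih (k + 1))).congr
      fun z hz => (hasDerivAt_ellipticMoment k hz).deriv

theorem ellipticMoment_ode {z : ℝ} (hz : -1 < z) :
    z * (1 + z) * (15 / 4 * ellipticMoment 2 z) + 2 * (1 + 2 * z) * (-(3 / 2) * ellipticMoment 1 z)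
      + 9 / 4 * ellipticMoment 0 z = 0 := by
  have hint : ∀ k r, IntervalIntegrable (fun θ => Real.sin θ ^ k *
      (1 + z * Real.sin θ ^ 2) ^ (r : ℝ)) volume 0 Real.pi := fun k r =>
    (Continuous.mul (by fun_prop) (Continuous.rpow_const (by fun_prop)
      fun θ => Or.inl (one_add_mul_sin_sq_pos hz θ).ne')).intervalIntegrable _ _
  unfold ellipticMoment
  rw [← intervalIntegral.integral_const_mul, ← intervalIntegral.integral_const_mul,
    ← intervalIntegral.integral_const_mul, ← intervalIntegral.integral_const_mul,
    ← intervalIntegral.integral_const_mul, ← intervalIntegral.integral_add,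
    ← intervalIntegral.integral_add]
  rotate_left
  · exact (((hint _ _).const_mul _).const_mul _).add (((hint _ _).const_mul _).const_mul _)
  · exact (hint _ _).const_mul _
  · exact ((hint _ _).const_mul _).const_mul _
  · exact ((hint _ _).const_mul _).const_mul _
  rw [intervalIntegral.integral_eq_sub_of_hasDerivAt (f := fun θ => 3 / 4 * (Real.sin θ ^ 3 *
    Real.cos θ * (1 + z * Real.sin θ ^ 2) ^ (-(5 / 2) : ℝ)))]
  · simp
  · intro θ _
    have hm := one_add_mul_sin_sq_pos hz θ
    have h1 : HasDerivAt (fun θ : ℝ => 1 + z * Real.sin θ ^ 2)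
        (z * (2 * Real.sin θ * Real.cos θ)) θ := by
      simpa using (((Real.hasDerivAt_sin θ).pow 2).const_mul z).const_add 1
    have h2 := ((((Real.hasDerivAt_sin θ).pow 3).mul (Real.hasDerivAt_cos θ)).mul
      (h1.rpow_const (p := (-(5 / 2) : ℝ)) (Or.inl hm.ne'))).const_mul (3 / 4)
    refine h2.congr_deriv ?_
    have e1 : (1 + z * Real.sin θ ^ 2) ^ (-(5 / 2) : ℝ) =
        (1 + z * Real.sin θ ^ 2) * (1 + z * Real.sin θ ^ 2) ^ (-(7 / 2) : ℝ) := by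
      rw [← Real.rpow_one_add' hm.le (by norm_num)]; norm_num
    have e2 : (1 + z * Real.sin θ ^ 2) ^ (-(3 / 2) : ℝ) =
        (1 + z * Real.sin θ ^ 2) ^ 2 * (1 + z * Real.sin θ ^ 2) ^ (-(7 / 2) : ℝ) := by
      rw [← Real.rpow_natCast (1 + z * Real.sin θ ^ 2) 2, ← Real.rpow_add hm]; norm_num
    have hc : Real.cos θ ^ 2 = 1 - Real.sin θ ^ 2 := Real.cos_sq' θ
    norm_num [e1, e2]
    generalize (1 + z * Real.sin θ ^ 2) ^ (-(7 / 2) : ℝ) = w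
    generalize Real.sin θ = a at *
    generalize Real.cos θ = b at *
    linear_combination (3 / 4 * w * (3 * a ^ 2 * (1 + z * a ^ 2) - 5 * z * a ^ 4)) * hc
  · exact ((((hint _ _).const_mul _).const_mul _).add
      (((hint _ _).const_mul _).const_mul _)).add ((hint _ _).const_mul _)

theorem ellipticMoment_zero_zero : ellipticMoment 0 0 = Real.pi / 2 := by
  simp [ellipticMoment, integral_sin_sq]

theorem interior_TriD : interior TriD = {p : ℝ × ℝ | 0 < p.1 ∧ 0 < p.2 ∧ p.1 + p.2 < 1} := by
  have h : TriD = (Ici 0 ×ˢ Ici 0) ∩ {p : ℝ × ℝ | p.1 + p.2 < 1} := by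
    ext p
    simp only [TriD, mem_ofPred_eq, mem_inter_iff, mem_prod, mem_Ici, and_assoc]
  have ho : IsOpen {p : ℝ × ℝ | p.1 + p.2 < 1} :=
    isOpen_lt (by fun_prop) continuous_const
  rw [h, interior_inter, interior_prod_eq, interior_Ici, ho.interior_eq]
  ext p; simp [and_assoc]

/-- The domain of the kernels: pairs `((x, y), s)` with `max x s < 1` and `max x s + y < 1`. -/
def kernelDomain : Set ((ℝ × ℝ) × ℝ) :=
  {q | q.1.1 < 1 ∧ q.2 < 1 ∧ q.1.1 + q.1.2 < 1 ∧ q.2 + q.1.2 < 1}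

theorem isOpen_kernelDomain : IsOpen kernelDomain := by
  simp only [kernelDomain, ofPred_and]
  refine .inter ?_ (.inter ?_ (.inter ?_ ?_)) <;> exact isOpen_lt (by fun_prop) (by fun_prop)

theorem mem_kernelDomain_of_mem_TriD {p : ℝ × ℝ} (hp : p ∈ TriD) {s : ℝ} (hs : s ≤ p.1) :
    (p, s) ∈ kernelDomain := by
  obtain ⟨h1, h2, h3⟩ := hp
  refine ⟨?_, ?_, ?_, ?_⟩ <;> dsimp only <;> linarith

/-- The Volterra integral `∫₀^x G((x, y), s) f(s) ds`. -/
def volterra (f : ℝ → ℝ) (G : (ℝ × ℝ) × ℝ → ℝ) (p : ℝ × ℝ) : ℝ :=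
  ∫ s in (0:ℝ)..p.1, G (p, s) * f s

theorem continuousOn_volterra {f : ℝ → ℝ} {G : (ℝ × ℝ) × ℝ → ℝ}
    (hf : ContinuousOn f (Ico 0 1)) (hG : ContinuousOn G kernelDomain) :
    ContinuousOn (volterra f G) TriD := by
  have h : ∀ p : ℝ × ℝ, volterra f G p =
      p.1 * ∫ u in (0:ℝ)..1, G (p, p.1 * u) * f (p.1 * u) := fun p => by
    have := intervalIntegral.mul_integral_comp_mul_left (a := 0) (b := 1)
      (f := fun s => G (p, s) * f s) (c := p.1)
    simpa [volterra] using this.symm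
  refine ContinuousOn.congr (continuousOn_fst.mul
    (continuousOn_intervalIntegral_of_continuousOn zero_le_one (ContinuousOn.mul ?_ ?_)))
    fun p _ => h p
  · refine hG.comp (by fun_prop) fun q hq => mem_kernelDomain_of_mem_TriD hq.1 ?_
    exact mul_le_of_le_one_right hq.1.1 hq.2.2
  · refine hf.comp (by fun_prop) fun q hq => ⟨mul_nonneg hq.1.1 hq.2.1, ?_⟩
    have := mul_le_of_le_one_right hq.1.1 hq.2.2
    have h3 := hq.1.2
    linarith

/-- The derivative of a kernel in its first variable. -/
def kernelX (G : (ℝ × ℝ) × ℝ → ℝ) (q : (ℝ × ℝ) × ℝ) : ℝ := fderiv ℝ G q ((1, 0), 0)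

/-- The derivative of a kernel in its second variable. -/
def kernelY (G : (ℝ × ℝ) × ℝ → ℝ) (q : (ℝ × ℝ) × ℝ) : ℝ := fderiv ℝ G q ((0, 1), 0)

theorem contDiffOn_fderiv_kernel {G : (ℝ × ℝ) × ℝ → ℝ} (hG : ContDiffOn ℝ ∞ G kernelDomain)
    (v : (ℝ × ℝ) × ℝ) : ContDiffOn ℝ ∞ (fun q => fderiv ℝ G q v) kernelDomain :=
  (hG.fderiv_of_isOpen isOpen_kernelDomain (by simp)).clm_apply contDiffOn_const

theorem hasFDerivAt_kernel {G : (ℝ × ℝ) × ℝ → ℝ} (hG : ContDiffOn ℝ ∞ G kernelDomain)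
    {p : ℝ × ℝ} {s : ℝ} (hq : (p, s) ∈ kernelDomain) :
    HasFDerivAt (fun p => G (p, s)) (kernelX G (p, s) • ContinuousLinearMap.fst ℝ ℝ ℝ +
      kernelY G (p, s) • ContinuousLinearMap.snd ℝ ℝ ℝ) p := by
  have h1 : HasFDerivAt G (fderiv ℝ G (p, s)) (p, s) :=
    ((hG.differentiableOn (by simp)).differentiableAt
      (isOpen_kernelDomain.mem_nhds hq)).hasFDerivAt
  have h2 := h1.comp p (f := fun p : ℝ × ℝ => (p, s)) (hasFDerivAt_prodMk_left p s)
  refine h2.congr_fderiv ?_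
  ext <;> simp [kernelX, kernelY]

theorem hasFDerivAt_volterra {f : ℝ → ℝ} {G : (ℝ × ℝ) × ℝ → ℝ}
    (hf : ContinuousOn f (Ico 0 1)) (hG : ContDiffOn ℝ ∞ G kernelDomain)
    {p : ℝ × ℝ} (hp : p ∈ interior TriD) :
    HasFDerivAt (volterra f G)
      ((volterra f (kernelX G) p + G (p, p.1) * f p.1) • ContinuousLinearMap.fst ℝ ℝ ℝ +
        volterra f (kernelY G) p • ContinuousLinearMap.snd ℝ ℝ ℝ) p := by
  have hp' := hp
  rw [interior_TriD] at hp'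
  obtain ⟨hx, hy, hxy⟩ := hp'
  have hGX : ContinuousOn (kernelX G) kernelDomain := (contDiffOn_fderiv_kernel hG _).continuousOn
  have hGY : ContinuousOn (kernelY G) kernelDomain := (contDiffOn_fderiv_kernel hG _).continuousOn
  have hfI : ContinuousOn f (Icc 0 p.1) := hf.mono fun s hs => ⟨hs.1, by linarith [hs.2]⟩
  -- the part with fixed endpoints
  set U : Set (ℝ × ℝ) := {q | q.1 < 1 ∧ q.1 + q.2 < 1 ∧ p.1 + q.2 < 1} with hUdef
  have hU : IsOpen U := by
    simp only [hUdef, ofPred_and]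
    refine .inter ?_ (.inter ?_ ?_) <;> exact isOpen_lt (by fun_prop) (by fun_prop)
  have hpU : p ∈ U := ⟨by linarith, hxy, hxy⟩
  have hUK : ∀ q ∈ U ×ˢ Icc 0 p.1, q ∈ kernelDomain := by
    rintro ⟨q, s⟩ ⟨⟨h1, h2, h3⟩, h4, h5⟩
    refine ⟨?_, ?_, ?_, ?_⟩ <;> dsimp only at * <;> linarith
  have hfU : ContinuousOn (fun q : (ℝ × ℝ) × ℝ => f q.2) (U ×ˢ Icc 0 p.1) :=
    hfI.comp continuousOn_snd fun q hq => hq.2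
  have hfix := hasFDerivAt_intervalIntegral_of_continuousOn (a := 0) (b := p.1)
    (F := fun q s => G (q, s) * f s)
    (F' := fun q s => (kernelX G (q, s) * f s) • ContinuousLinearMap.fst ℝ ℝ ℝ +
      (kernelY G (q, s) * f s) • ContinuousLinearMap.snd ℝ ℝ ℝ) hU hx.le
    ((hG.continuousOn.mono hUK).mul hfU)
    ((((hGX.mono hUK).mul hfU).smul continuousOn_const).add
      (((hGY.mono hUK).mul hfU).smul continuousOn_const))
    (fun q hq s hs => by
      refine ((hasFDerivAt_kernel hG (hUK (q, s) ⟨hq, hs⟩)).mul_const (f s)).congr_fderiv ?_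
      simp only [smul_add, smul_smul, mul_comm])
    hpU
  have hslice : ContinuousOn (fun s : ℝ => (p, s)) (Icc 0 p.1) := by fun_prop
  have hsliceK : MapsTo (fun s : ℝ => (p, s)) (Icc 0 p.1) kernelDomain :=
    fun s hs => hUK (p, s) ⟨hpU, hs⟩
  have hint : ∀ {g : (ℝ × ℝ) × ℝ → ℝ}, ContinuousOn g kernelDomain →
      ∀ l : ℝ × ℝ →L[ℝ] ℝ, IntervalIntegrable (fun s => (g (p, s) * f s) • l) volume 0 p.1 :=
    fun {g} hg l =>
    ContinuousOn.intervalIntegrable (by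
      rw [uIcc_of_le hx.le]; exact ((hg.comp hslice hsliceK).mul hfI).smul continuousOn_const)
  rw [intervalIntegral.integral_add (hint hGX _) (hint hGY _),
    intervalIntegral.integral_smul_const, intervalIntegral.integral_smul_const] at hfix
  -- the part with a moving endpoint
  have hev : ∀ᶠ q in 𝓝 (p, p.1), q ∈ kernelDomain ∧ q.2 ∈ Ioo (0:ℝ) 1 := by
    refine (isOpen_kernelDomain.eventually_mem
      (mem_kernelDomain_of_mem_TriD (interior_subset hp) le_rfl)).and ?_
    exact continuousAt_snd.preimage_mem_nhds (Ioo_mem_nhds hx (by linarith))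
  have hmov := hasFDerivAt_intervalIntegral_endpoint (g := fun q => G q * f q.2)
    (ContinuousLinearMap.fst ℝ ℝ ℝ) (p₀ := p) (by
      refine hev.mono fun q hq => ContinuousAt.mul
        (hG.continuousOn.continuousAt (isOpen_kernelDomain.mem_nhds hq.1)) ?_
      exact (hf.continuousAt (Ico_mem_nhds hq.2.1 hq.2.2)).comp continuousAt_snd)
  refine ((hfix.add hmov).congr_of_eventuallyEq ?_).congr_fderiv ?_
  · have hnear : ∀ᶠ q in 𝓝 p, q ∈ U ∧ q ∈ interior TriD :=
      (hU.eventually_mem hpU).and (isOpen_interior.eventually_mem hp)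
    filter_upwards [hnear] with q hq
    have hqD := interior_subset hq.2
    have hmax : ∀ s ∈ Icc 0 (max p.1 q.1), (q, s) ∈ kernelDomain := by
      rintro s ⟨hs0, hs⟩
      rcases le_max_iff.1 hs with h | h
      · exact hUK (q, s) ⟨hq.1, hs0, h⟩
      · exact mem_kernelDomain_of_mem_TriD hqD h
    have hcont : ContinuousOn (fun s => G (q, s) * f s) (Icc 0 (max p.1 q.1)) :=
      (hG.continuousOn.comp (by fun_prop) hmax).mul
        (hf.mono fun s hs => ⟨hs.1, (hmax s hs).2.1⟩)
    have hI : ∀ {a b}, a ∈ Icc 0 (max p.1 q.1) → b ∈ Icc 0 (max p.1 q.1) →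
        IntervalIntegrable (fun s => G (q, s) * f s) volume a b := fun ha hb =>
      (hcont.mono (ordConnected_Icc.uIcc_subset ha hb)).intervalIntegrable
    have h0 : (0:ℝ) ∈ Icc 0 (max p.1 q.1) := ⟨le_rfl, le_max_of_le_left hx.le⟩
    have h1 : p.1 ∈ Icc 0 (max p.1 q.1) := ⟨hx.le, le_max_left _ _⟩
    have h2 : q.1 ∈ Icc 0 (max p.1 q.1) := ⟨hqD.1, le_max_right _ _⟩
    exact (intervalIntegral.integral_add_adjacent_intervals (hI h0 h1) (hI h1 h2)).symm
  · ext <;> simp [volterra]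

theorem contDiffOn_volterra {f : ℝ → ℝ} (hf : ContinuousOn f (Ico 0 1)) (k : ℕ)
    (hfk : ContDiffOn ℝ k f (Ioo 0 1)) {G : (ℝ × ℝ) × ℝ → ℝ}
    (hG : ContDiffOn ℝ ∞ G kernelDomain) : ContDiffOn ℝ k (volterra f G) (interior TriD) := by
  induction k generalizing G with
  | zero =>
    exact contDiffOn_zero.2 ((continuousOn_volterra hf hG.continuousOn).mono interior_subset)
  | succ k ih =>
    have hfk' : ContDiffOn ℝ k f (Ioo 0 1) := hfk.of_le (by simp)
    rw [Nat.cast_succ, contDiffOn_succ_iff_hasFDerivWithinAt_of_uniqueDiffOn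
      isOpen_interior.uniqueDiffOn]
    refine ⟨by simp, _, ?_, fun p hp => (hasFDerivAt_volterra hf hG hp).hasFDerivWithinAt⟩
    have hdiag : ContDiffOn ℝ k (fun p : ℝ × ℝ => G (p, p.1) * f p.1) (interior TriD) := by
      refine ContDiffOn.mul ((hG.of_le (by exact_mod_cast le_top)).comp
        (f := fun p : ℝ × ℝ => (p, p.1)) (by fun_prop) fun p hp =>
          mem_kernelDomain_of_mem_TriD (interior_subset hp) le_rfl)
        (hfk'.comp contDiffOn_fst fun p hp => ?_)
      rw [interior_TriD] at hp
      exact ⟨hp.1, by linarith [hp.2.1, hp.2.2]⟩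
    exact (((ih hfk' (contDiffOn_fderiv_kernel hG _)).add hdiag).smul contDiffOn_const).add
      ((ih hfk' (contDiffOn_fderiv_kernel hG _)).smul contDiffOn_const)

theorem HasFDerivAt.hasDerivAt_fst_slice {F : ℝ × ℝ → ℝ} {a b x y : ℝ}
    (h : HasFDerivAt F (a • ContinuousLinearMap.fst ℝ ℝ ℝ + b • ContinuousLinearMap.snd ℝ ℝ ℝ)
      (x, y)) : HasDerivAt (fun t => F (t, y)) a x :=
  (h.comp_hasDerivAt x ((hasDerivAt_id x).prodMk (hasDerivAt_const x y))).congr_deriv (by simp)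

theorem HasFDerivAt.hasDerivAt_snd_slice {F : ℝ × ℝ → ℝ} {a b x y : ℝ}
    (h : HasFDerivAt F (a • ContinuousLinearMap.fst ℝ ℝ ℝ + b • ContinuousLinearMap.snd ℝ ℝ ℝ)
      (x, y)) : HasDerivAt (fun t => F (x, t)) b y :=
  (h.comp_hasDerivAt y ((hasDerivAt_const y x).prodMk (hasDerivAt_id y))).congr_deriv (by simp)

theorem hasDerivAt_kernelX {G : (ℝ × ℝ) × ℝ → ℝ} (hG : ContDiffOn ℝ ∞ G kernelDomain)
    {x y s : ℝ} (hq : ((x, y), s) ∈ kernelDomain) :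
    HasDerivAt (fun t => G ((t, y), s)) (kernelX G ((x, y), s)) x :=
  (hasFDerivAt_kernel hG hq).hasDerivAt_fst_slice

theorem hasDerivAt_kernelY {G : (ℝ × ℝ) × ℝ → ℝ} (hG : ContDiffOn ℝ ∞ G kernelDomain)
    {x y s : ℝ} (hq : ((x, y), s) ∈ kernelDomain) :
    HasDerivAt (fun t => G ((x, t), s)) (kernelY G ((x, y), s)) y :=
  (hasFDerivAt_kernel hG hq).hasDerivAt_snd_slice

/-- The similarity variable on which the Riemann function of `U_xy = -U / (4 (1 - x - y)²)` with
base point on the axis `y = 0` depends. -/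
def riemannVariable (q : (ℝ × ℝ) × ℝ) : ℝ :=
  (q.1.1 - q.2) * q.1.2 / ((1 - q.2) * (1 - q.1.1 - q.1.2))

/-- Minus the derivative in `s` of the Riemann function of `U_xy = -U / (4 (1 - x - y)²)` with
base point `(s, 0)`. -/
def riemannKernel (q : (ℝ × ℝ) × ℝ) : ℝ :=
  -(1 / (2 * Real.pi)) * (q.1.2 * (1 - q.1.1) / ((1 - q.1.1 - q.1.2) * (1 - q.2) ^ 2)) *
    ellipticMoment 0 (riemannVariable q)

theorem neg_one_lt_riemannVariable {q : (ℝ × ℝ) × ℝ} (hq : q ∈ kernelDomain) :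
    -1 < riemannVariable q := by
  obtain ⟨⟨x, y⟩, s⟩ := q
  obtain ⟨h1, h2, h3, h4⟩ := hq
  dsimp only at h1 h2 h3 h4
  have hs : 0 < 1 - s := by linarith
  have hd : 0 < 1 - x - y := by linarith
  rw [riemannVariable, lt_div_iff₀ (mul_pos hs hd)]
  nlinarith [mul_pos (sub_pos.2 h1) (show 0 < 1 - s - y by linarith)]

theorem contDiffOn_riemannKernel : ContDiffOn ℝ ∞ riemannKernel kernelDomain := by
  have hd : ∀ q ∈ kernelDomain, 1 - q.1.1 - q.1.2 ≠ 0 := fun q hq => by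
    have := hq.2.2.1
    linarith
  have hs : ∀ q ∈ kernelDomain, 1 - q.2 ≠ 0 := fun q hq => by
    have := hq.2.1
    linarith
  have hz : ContDiffOn ℝ ∞ riemannVariable kernelDomain :=
    ContDiffOn.div (by fun_prop) (by fun_prop) fun q hq => mul_ne_zero (hs q hq) (hd q hq)
  refine ContDiffOn.mul (contDiffOn_const.mul (ContDiffOn.div (by fun_prop) (by fun_prop)
    fun q hq => mul_ne_zero (hd q hq) (pow_ne_zero 2 (hs q hq)))) ?_
  exact (contDiffOn_infty.2 fun m => contDiffOn_ellipticMoment m 0).comp hz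
    fun q hq => neg_one_lt_riemannVariable hq

theorem kernelY_riemannKernel {q : (ℝ × ℝ) × ℝ} (hq : q ∈ kernelDomain) :
    kernelY riemannKernel q = -(1 / (2 * Real.pi)) *
      ((1 - q.1.1) ^ 2 / ((1 - q.1.1 - q.1.2) ^ 2 * (1 - q.2) ^ 2)) *
      (ellipticMoment 0 (riemannVariable q) -
        3 / 2 * riemannVariable q * ellipticMoment 1 (riemannVariable q)) := by
  obtain ⟨⟨x, y⟩, s⟩ := q
  refine (hasDerivAt_kernelY contDiffOn_riemannKernel hq).unique ?_
  have hJ := hasDerivAt_ellipticMoment 0 (neg_one_lt_riemannVariable hq)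
  obtain ⟨h1, h2, h3, h4⟩ := hq
  dsimp only at h1 h2 h3 h4
  have hs : 1 - s ≠ 0 := by linarith
  have hd : 1 - x - y ≠ 0 := by linarith
  have hd' : HasDerivAt (fun t : ℝ => 1 - x - t) (-1) y := (hasDerivAt_id y).const_sub (1 - x)
  have hz : HasDerivAt (fun t => riemannVariable ((x, t), s))
      ((x - s) * (1 - x) / ((1 - s) * (1 - x - y) ^ 2)) y := by
    refine (((hasDerivAt_id y).const_mul (x - s)).div (hd'.const_mul (1 - s))
      (mul_ne_zero hs hd)).congr_deriv ?_
    simp only [id]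
    field_simp
    ring
  have ha : HasDerivAt (fun t => t * (1 - x) / ((1 - x - t) * (1 - s) ^ 2))
      ((1 - x) ^ 2 / ((1 - x - y) ^ 2 * (1 - s) ^ 2)) y := by
    refine (((hasDerivAt_id y).mul_const (1 - x)).div (hd'.mul_const ((1 - s) ^ 2))
      (mul_ne_zero hd (pow_ne_zero 2 hs))).congr_deriv ?_
    simp only [id]
    field_simp
    ring
  refine ((ha.const_mul (-(1 / (2 * Real.pi)))).mul (hJ.comp y hz)).congr_deriv ?_
  simp only [Function.comp_apply]
  have hzv : riemannVariable ((x, y), s) = (x - s) * y / ((1 - s) * (1 - x - y)) := rfl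
  have hpi := Real.pi_ne_zero
  generalize ellipticMoment 0 (riemannVariable ((x, y), s)) = a₀
  generalize ellipticMoment (0 + 1) (riemannVariable ((x, y), s)) = a₁
  rw [hzv]
  field_simp
  push_cast
  ring

theorem kernelX_kernelY_riemannKernel {q : (ℝ × ℝ) × ℝ} (hq : q ∈ kernelDomain) :
    kernelX (kernelY riemannKernel) q =
      -(1 / (4 * (1 - q.1.1 - q.1.2) ^ 2)) * riemannKernel q := by
  obtain ⟨⟨x, y⟩, s⟩ := q
  refine (hasDerivAt_kernelX (contDiffOn_fderiv_kernel contDiffOn_riemannKernel _) hq).unique ?_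
  have hev : ∀ᶠ t in 𝓝 x, ((t, y), s) ∈ kernelDomain :=
    (by fun_prop : ContinuousAt (fun t : ℝ => ((t, y), s)) x).eventually
      (isOpen_kernelDomain.eventually_mem hq)
  refine HasDerivAt.congr_of_eventuallyEq ?_ (hev.mono fun t ht => kernelY_riemannKernel ht)
  have hJ0 := hasDerivAt_ellipticMoment 0 (neg_one_lt_riemannVariable hq)
  have hJ1 := hasDerivAt_ellipticMoment 1 (neg_one_lt_riemannVariable hq)
  have hode := ellipticMoment_ode (neg_one_lt_riemannVariable hq)
  obtain ⟨h1, h2, h3, h4⟩ := hq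
  dsimp only at h1 h2 h3 h4
  have hs : 1 - s ≠ 0 := by linarith
  have hd : 1 - x - y ≠ 0 := by linarith
  have hd' : HasDerivAt (fun t : ℝ => 1 - t - y) (-1) x :=
    ((hasDerivAt_id x).const_sub 1).sub_const y
  have hz : HasDerivAt (fun t => riemannVariable ((t, y), s))
      (y * (1 - y - s) / ((1 - s) * (1 - x - y) ^ 2)) x := by
    refine ((((hasDerivAt_id x).sub_const s).mul_const y).div (hd'.const_mul (1 - s))
      (mul_ne_zero hs hd)).congr_deriv ?_
    simp only [id]
    field_simp
    ring
  have ha : HasDerivAt (fun t => (1 - t) ^ 2 / ((1 - t - y) ^ 2 * (1 - s) ^ 2))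
      (2 * (1 - x) * y / ((1 - x - y) ^ 3 * (1 - s) ^ 2)) x := by
    refine ((((hasDerivAt_id x).const_sub 1).pow 2).div ((hd'.pow 2).mul_const ((1 - s) ^ 2))
      (mul_ne_zero (pow_ne_zero 2 hd) (pow_ne_zero 2 hs))).congr_deriv ?_
    simp only [id, Pi.pow_apply]
    field_simp
    ring
  refine ((ha.const_mul (-(1 / (2 * Real.pi)))).mul ((hJ0.comp x hz).sub
    ((hz.const_mul (3 / 2)).mul (hJ1.comp x hz)))).congr_deriv ?_
  simp only [Function.comp_apply, Pi.sub_apply, Pi.mul_apply, riemannKernel]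
  have hzv : riemannVariable ((x, y), s) = (x - s) * y / ((1 - s) * (1 - x - y)) := rfl
  have hzv' : 1 + riemannVariable ((x, y), s) =
      (1 - x) * (1 - y - s) / ((1 - s) * (1 - x - y)) := by
    rw [hzv]; field_simp; ring
  have hzx : y * (1 - y - s) / ((1 - s) * (1 - x - y) ^ 2) * (1 - x) =
    (1 + riemannVariable ((x, y), s)) * y / (1 - x - y) := by
      rw [hzv']; field_simp
  norm_num at hode ⊢
  generalize ellipticMoment 0 (riemannVariable ((x, y), s)) = a₀ at *
  generalize ellipticMoment 1 (riemannVariable ((x, y), s)) = a₁ at *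
  generalize ellipticMoment 2 (riemannVariable ((x, y), s)) = a₂ at *
  generalize riemannVariable ((x, y), s) = z at *
  clear hev hJ0 hJ1 hd' hz ha hzv hzv'
  generalize y * (1 - y - s) / ((1 - s) * (1 - x - y) ^ 2) = zx at hzx ⊢
  generalize 1 - x - y = d at hzx ⊢
  generalize 1 - s = r
  linear_combination (-(1 / (2 * Real.pi)) * ((1 - x) / (d ^ 2 * r ^ 2)) *
    (15 / 4 * z * a₂ - 3 * a₁)) * hzx +
    (-(1 / (2 * Real.pi)) * ((1 - x) * y / (d ^ 3 * r ^ 2))) * hode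

theorem kernelY_riemannKernel_diag {p : ℝ × ℝ} (hp : p ∈ TriD) :
    kernelY riemannKernel (p, p.1) = -(1 / (4 * (1 - p.1 - p.2) ^ 2)) := by
  have hq := mem_kernelDomain_of_mem_TriD hp le_rfl
  have h1 : 1 - p.1 ≠ 0 := by
    have := hq.1
    dsimp only at this
    linarith
  have h2 : 1 - p.1 - p.2 ≠ 0 := by linarith [hp.2.2]
  rw [kernelY_riemannKernel hq]
  have hz : riemannVariable (p, p.1) = 0 := by simp [riemannVariable]
  have hpi := Real.pi_ne_zero
  rw [hz, ellipticMoment_zero_zero]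
  field_simp
  ring

section Partials

variable {V W : ℝ → ℝ → ℝ} {Ω : Set (ℝ × ℝ)} {x y : ℝ}

theorem IsOpen.eventually_mem_fst_slice (hΩ : IsOpen Ω) (hp : (x, y) ∈ Ω) :
    ∀ᶠ t in 𝓝 x, (t, y) ∈ Ω :=
  (by fun_prop : ContinuousAt (fun t : ℝ => (t, y)) x).eventually (hΩ.eventually_mem hp)

theorem IsOpen.eventually_mem_snd_slice (hΩ : IsOpen Ω) (hp : (x, y) ∈ Ω) :
    ∀ᶠ t in 𝓝 y, (x, t) ∈ Ω :=
  (by fun_prop : ContinuousAt (fun t : ℝ => (x, t)) y).eventually (hΩ.eventually_mem hp)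

theorem hasFDerivAt_uncurry_of_contDiffOn (hΩ : IsOpen Ω)
    (hV : ContDiffOn ℝ 1 (fun p : ℝ × ℝ => V p.1 p.2) Ω) (hp : (x, y) ∈ Ω) :
    HasFDerivAt (fun p : ℝ × ℝ => V p.1 p.2)
      (fderiv ℝ (fun p : ℝ × ℝ => V p.1 p.2) (x, y)) (x, y) :=
  ((hV.differentiableOn one_ne_zero).differentiableAt (hΩ.mem_nhds hp)).hasFDerivAt

theorem hasDerivAt_fst_slice_fderiv (hΩ : IsOpen Ω)
    (hV : ContDiffOn ℝ 1 (fun p : ℝ × ℝ => V p.1 p.2) Ω) (hp : (x, y) ∈ Ω) :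
    HasDerivAt (fun t => V t y) (fderiv ℝ (fun p : ℝ × ℝ => V p.1 p.2) (x, y) (1, 0)) x :=
  (hasFDerivAt_uncurry_of_contDiffOn hΩ hV hp).comp_hasDerivAt x (f := fun t => (t, y))
    ((hasDerivAt_id x).prodMk (hasDerivAt_const x y))

theorem hasDerivAt_snd_slice_fderiv (hΩ : IsOpen Ω)
    (hV : ContDiffOn ℝ 1 (fun p : ℝ × ℝ => V p.1 p.2) Ω) (hp : (x, y) ∈ Ω) :
    HasDerivAt (fun t => V x t) (fderiv ℝ (fun p : ℝ × ℝ => V p.1 p.2) (x, y) (0, 1)) y :=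
  (hasFDerivAt_uncurry_of_contDiffOn hΩ hV hp).comp_hasDerivAt y (f := fun t => (x, t))
    ((hasDerivAt_const y x).prodMk (hasDerivAt_id y))

theorem hasDerivAt_pdxR (hΩ : IsOpen Ω)
    (hV : ContDiffOn ℝ 1 (fun p : ℝ × ℝ => V p.1 p.2) Ω) (hp : (x, y) ∈ Ω) :
    HasDerivAt (fun t => V t y) (pdxR V x y) x :=
  (hasDerivAt_fst_slice_fderiv hΩ hV hp).differentiableAt.hasDerivAt

theorem hasDerivAt_pdyR (hΩ : IsOpen Ω)
    (hV : ContDiffOn ℝ 1 (fun p : ℝ × ℝ => V p.1 p.2) Ω) (hp : (x, y) ∈ Ω) :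
    HasDerivAt (fun t => V x t) (pdyR V x y) y :=
  (hasDerivAt_snd_slice_fderiv hΩ hV hp).differentiableAt.hasDerivAt

theorem contDiffOn_pdyR (hΩ : IsOpen Ω)
    (hV : ContDiffOn ℝ 2 (fun p : ℝ × ℝ => V p.1 p.2) Ω) :
    ContDiffOn ℝ 1 (fun p : ℝ × ℝ => pdyR V p.1 p.2) Ω :=
  ((hV.fderiv_of_isOpen (m := 1) hΩ (by norm_num)).clm_apply
    (contDiffOn_const (c := ((0 : ℝ), (1 : ℝ))))).congr fun _ hp =>
      (hasDerivAt_snd_slice_fderiv hΩ (hV.of_le (by norm_num)) hp).deriv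

theorem hasDerivAt_pdxyR (hΩ : IsOpen Ω)
    (hV : ContDiffOn ℝ 2 (fun p : ℝ × ℝ => V p.1 p.2) Ω) (hp : (x, y) ∈ Ω) :
    HasDerivAt (fun t => pdyR V t y) (pdxyR V x y) x :=
  hasDerivAt_pdxR hΩ (contDiffOn_pdyR hΩ hV) hp

/-- The mixed partial derivatives of a `C²` function agree. -/
theorem pdyR_pdxR_eq_pdxyR (hΩ : IsOpen Ω)
    (hV : ContDiffOn ℝ 2 (fun p : ℝ × ℝ => V p.1 p.2) Ω) (hp : (x, y) ∈ Ω) :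
    pdyR (pdxR V) x y = pdxyR V x y := by
  have hV1 : ContDiffOn ℝ 1 (fun p : ℝ × ℝ => V p.1 p.2) Ω := hV.of_le (by norm_num)
  have hd : DifferentiableAt ℝ (fderiv ℝ fun p : ℝ × ℝ => V p.1 p.2) (x, y) :=
    ((hV.fderiv_of_isOpen (m := 1) hΩ (by norm_num)).differentiableOn one_ne_zero).differentiableAt
      (hΩ.mem_nhds hp)
  have hsymm : IsSymmSndFDerivAt ℝ (fun p : ℝ × ℝ => V p.1 p.2) (x, y) :=
    (hV.contDiffAt (hΩ.mem_nhds hp)).isSymmSndFDerivAt (by simp)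
  unfold IsSymmSndFDerivAt at hsymm
  generalize hF' : fderiv ℝ (fun p : ℝ × ℝ => V p.1 p.2) = F' at hd hsymm
  have key : ∀ v : ℝ × ℝ, HasFDerivAt (fun p => F' p v)
      ((ContinuousLinearMap.apply ℝ ℝ v).comp (fderiv ℝ F' (x, y))) (x, y) := fun v =>
    (ContinuousLinearMap.apply ℝ ℝ v).hasFDerivAt.comp (x, y) hd.hasFDerivAt
  have h1 : HasDerivAt (fun t => F' (x, t) (1, 0)) (fderiv ℝ F' (x, y) (0, 1) (1, 0)) y :=
    (key (1, 0)).comp_hasDerivAt y (f := fun t => (x, t))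
      ((hasDerivAt_const y x).prodMk (hasDerivAt_id y))
  have h2 : HasDerivAt (fun t => F' (t, y) (0, 1)) (fderiv ℝ F' (x, y) (1, 0) (0, 1)) x :=
    (key (0, 1)).comp_hasDerivAt x (f := fun t => (t, y))
      ((hasDerivAt_id x).prodMk (hasDerivAt_const x y))
  subst hF'
  have h1' : pdyR (pdxR V) x y =
      fderiv ℝ (fderiv ℝ fun p : ℝ × ℝ => V p.1 p.2) (x, y) (0, 1) (1, 0) :=
    (h1.congr_of_eventuallyEq ((hΩ.eventually_mem_snd_slice hp).mono fun t ht =>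
      (hasDerivAt_fst_slice_fderiv hΩ hV1 ht).deriv)).deriv
  have h2' : pdxyR V x y =
      fderiv ℝ (fderiv ℝ fun p : ℝ × ℝ => V p.1 p.2) (x, y) (1, 0) (0, 1) :=
    (h2.congr_of_eventuallyEq ((hΩ.eventually_mem_fst_slice hp).mono fun t ht =>
      (hasDerivAt_snd_slice_fderiv hΩ hV1 ht).deriv)).deriv
  rw [h1', h2', hsymm]

theorem pdxR_add_const_mul (hΩ : IsOpen Ω)
    (hV : ContDiffOn ℝ 1 (fun p : ℝ × ℝ => V p.1 p.2) Ω)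
    (hW : ContDiffOn ℝ 1 (fun p : ℝ × ℝ => W p.1 p.2) Ω) (c : ℝ) (hp : (x, y) ∈ Ω) :
    pdxR (fun x y => V x y + c * W x y) x y = pdxR V x y + c * pdxR W x y :=
  ((hasDerivAt_pdxR hΩ hV hp).add ((hasDerivAt_pdxR hΩ hW hp).const_mul c)).deriv

theorem pdyR_add_const_mul (hΩ : IsOpen Ω)
    (hV : ContDiffOn ℝ 1 (fun p : ℝ × ℝ => V p.1 p.2) Ω)
    (hW : ContDiffOn ℝ 1 (fun p : ℝ × ℝ => W p.1 p.2) Ω) (c : ℝ) (hp : (x, y) ∈ Ω) :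
    pdyR (fun x y => V x y + c * W x y) x y = pdyR V x y + c * pdyR W x y :=
  ((hasDerivAt_pdyR hΩ hV hp).add ((hasDerivAt_pdyR hΩ hW hp).const_mul c)).deriv

theorem pdxyR_add_const_mul (hΩ : IsOpen Ω)
    (hV : ContDiffOn ℝ 2 (fun p : ℝ × ℝ => V p.1 p.2) Ω)
    (hW : ContDiffOn ℝ 2 (fun p : ℝ × ℝ => W p.1 p.2) Ω) (c : ℝ) (hp : (x, y) ∈ Ω) :
    pdxyR (fun x y => V x y + c * W x y) x y = pdxyR V x y + c * pdxyR W x y :=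
  (((hasDerivAt_pdxyR hΩ hV hp).add ((hasDerivAt_pdxyR hΩ hW hp).const_mul c)).congr_of_eventuallyEq
    ((hΩ.eventually_mem_fst_slice hp).mono fun t ht => pdyR_add_const_mul hΩ
      (hV.of_le (by norm_num)) (hW.of_le (by norm_num)) c ht)).deriv

theorem EulerDarbouxAt.add_const_mul (hΩ : IsOpen Ω)
    (hV : ContDiffOn ℝ 2 (fun p : ℝ × ℝ => V p.1 p.2) Ω)
    (hW : ContDiffOn ℝ 2 (fun p : ℝ × ℝ => W p.1 p.2) Ω) (c : ℝ) (hp : (x, y) ∈ Ω)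
    (hEV : EulerDarbouxAt V x y) (hEW : EulerDarbouxAt W x y) :
    EulerDarbouxAt (fun x y => V x y + c * W x y) x y := by
  have hV1 : ContDiffOn ℝ 1 (fun p : ℝ × ℝ => V p.1 p.2) Ω := hV.of_le (by norm_num)
  have hW1 : ContDiffOn ℝ 1 (fun p : ℝ × ℝ => W p.1 p.2) Ω := hW.of_le (by norm_num)
  unfold EulerDarbouxAt at *
  rw [pdxR_add_const_mul hΩ hV1 hW1 c hp, pdyR_add_const_mul hΩ hV1 hW1 c hp,
    pdxyR_add_const_mul hΩ hV hW c hp]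
  linear_combination hEV + c * hEW

end Partials

theorem EDSolutionWith.add {n : ℕ} (hn : 2 ≤ n) {α : ℝ} {V W : ℝ → ℝ → ℝ} {V0 V1 W0 W1 : ℝ → ℝ}
    (hV : EDSolutionWith n α V V0 V1) (hW : EDSolutionWith n α W W0 W1) :
    EDSolutionWith n α (fun x y => V x y + 1 * W x y) (fun x => V0 x + W0 x)
      (fun y => V1 y + W1 y) := by
  obtain ⟨hVc, hVd, hVe, ⟨gx, hgx, hgx'⟩, ⟨gy, hgy, hgy'⟩, ⟨gxy, hgxy, hgxy'⟩, hV0, hV1⟩ := hV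
  obtain ⟨hWc, hWd, hWe, ⟨kx, hkx, hkx'⟩, ⟨ky, hky, hky'⟩, ⟨kxy, hkxy, hkxy'⟩, hW0, hW1⟩ := hW
  have hVd2 := hVd.of_le (m := 2) (by exact_mod_cast hn)
  have hWd2 := hWd.of_le (m := 2) (by exact_mod_cast hn)
  have hVd1 := hVd2.of_le (m := 1) (by norm_num)
  have hWd1 := hWd2.of_le (m := 1) (by norm_num)
  refine ⟨hVc.add (continuousOn_const.mul hWc), hVd.add (contDiffOn_const.mul hWd),
    fun p hp => (hVe p hp).add_const_mul isOpen_interior hVd2 hWd2 1 hp (hWe p hp),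
    ⟨gx + kx, hgx.add hkx, fun p hp => ?_⟩, ⟨gy + ky, hgy.add hky, fun p hp => ?_⟩,
    ⟨gxy + kxy, hgxy.add hkxy, fun p hp => ?_⟩, fun x hx => ?_, fun y hy => ?_⟩
  · rw [pdxR_add_const_mul isOpen_interior hVd1 hWd1 1 hp, Pi.add_apply, hgx' p hp, hkx' p hp]
    ring
  · rw [pdyR_add_const_mul isOpen_interior hVd1 hWd1 1 hp, Pi.add_apply, hgy' p hp, hky' p hp]
    ring
  · rw [pdxyR_add_const_mul isOpen_interior hVd2 hWd2 1 hp, Pi.add_apply, hgxy' p hp, hkxy' p hp]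
    ring
  · simp only [hV0 x hx, hW0 x hx, one_mul]
  · simp only [hV1 y hy, hW1 y hy, one_mul]

theorem swap_mem_TriD {p : ℝ × ℝ} (hp : p ∈ TriD) : p.swap ∈ TriD :=
  ⟨hp.2.1, hp.1, by simpa [add_comm] using hp.2.2⟩

theorem swap_mem_interior_TriD {p : ℝ × ℝ} (hp : p ∈ interior TriD) :
    p.swap ∈ interior TriD := by
  rw [interior_TriD] at *
  exact ⟨hp.2.1, hp.1, by simpa [add_comm] using hp.2.2⟩

/-- Exchanging the variables exchanges the data of a solution. -/
theorem EDSolutionWith.swap {n : ℕ} (hn : 2 ≤ n) {α : ℝ} {V : ℝ → ℝ → ℝ} {V0 V1 : ℝ → ℝ}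
    (hV : EDSolutionWith n α V V0 V1) : EDSolutionWith n α (fun x y => V y x) V1 V0 := by
  obtain ⟨hVc, hVd, hVe, ⟨gx, hgx, hgx'⟩, ⟨gy, hgy, hgy'⟩, ⟨gxy, hgxy, hgxy'⟩, hV0, hV1⟩ := hV
  have hVd2 := hVd.of_le (m := 2) (by exact_mod_cast hn)
  have hxy : ∀ p ∈ interior TriD, pdxyR (fun x y => V y x) p.1 p.2 = pdxyR V p.2 p.1 :=
    fun p hp => pdyR_pdxR_eq_pdxyR isOpen_interior hVd2 (swap_mem_interior_TriD hp)
  refine ⟨hVc.comp continuous_swap.continuousOn fun p => swap_mem_TriD,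
    hVd.comp (contDiff_snd.prodMk contDiff_fst).contDiffOn
      fun p => swap_mem_interior_TriD, fun p hp => ?_,
    ⟨gy ∘ Prod.swap, hgy.comp continuous_swap.continuousOn fun p => swap_mem_TriD,
      fun p hp => hgy' p.swap (swap_mem_interior_TriD hp)⟩,
    ⟨gx ∘ Prod.swap, hgx.comp continuous_swap.continuousOn fun p => swap_mem_TriD,
      fun p hp => hgx' p.swap (swap_mem_interior_TriD hp)⟩,
    ⟨gxy ∘ Prod.swap, hgxy.comp continuous_swap.continuousOn fun p => swap_mem_TriD,
      fun p hp => ?_⟩, hV1, hV0⟩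
  · have h := hVe p.swap (swap_mem_interior_TriD hp)
    simp only [EulerDarbouxAt, Prod.fst_swap, Prod.snd_swap] at h ⊢
    rw [hxy p hp, ← h, sub_right_comm 1 p.2 p.1, add_comm (pdxR V p.2 p.1)]
    rfl
  · rw [hxy p hp, Function.comp_apply, hgxy' p.swap (swap_mem_interior_TriD hp), mul_comm (_ ^ α)]
    rfl

theorem HasDerivAt.inv_sqrt {g : ℝ → ℝ} {x : ℝ} (hg : HasDerivAt g (-1) x) (hx : 0 < g x) :
    HasDerivAt (fun t => (√(g t))⁻¹) ((√(g x))⁻¹ / (2 * g x)) x := by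
  refine ((hg.sqrt hx.ne').inv (Real.sqrt_pos.2 hx).ne').congr_deriv ?_
  rw [Real.sq_sqrt hx.le]
  have := (Real.sqrt_pos.2 hx).ne'
  field_simp

/-- The solution of `U_xy = -U / (4 (1 - x - y)²)` with `U(x, 0) = f(x)` and `U(0, y) = f(0)`
where `f(0) = 0`. -/
def goursatHalf (f : ℝ → ℝ) (p : ℝ × ℝ) : ℝ := f p.1 + volterra f riemannKernel p

section GoursatHalf

variable {f : ℝ → ℝ}

theorem fst_mem_Ico_of_mem_TriD {p : ℝ × ℝ} (hp : p ∈ TriD) : p.1 ∈ Ico (0 : ℝ) 1 :=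
  ⟨hp.1, by linarith [hp.2.1, hp.2.2]⟩

theorem fst_mem_Ioo_of_mem_interior_TriD {p : ℝ × ℝ} (hp : p ∈ interior TriD) :
    p.1 ∈ Ioo (0 : ℝ) 1 := by
  rw [interior_TriD] at hp
  exact ⟨hp.1, by linarith [hp.2.1, hp.2.2]⟩

theorem contDiffOn_kernelX_riemannKernel : ContDiffOn ℝ ∞ (kernelX riemannKernel) kernelDomain :=
  contDiffOn_fderiv_kernel contDiffOn_riemannKernel _

theorem contDiffOn_kernelY_riemannKernel : ContDiffOn ℝ ∞ (kernelY riemannKernel) kernelDomain :=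
  contDiffOn_fderiv_kernel contDiffOn_riemannKernel _

theorem continuousOn_goursatHalf (hf : ContinuousOn f (Ico 0 1)) :
    ContinuousOn (goursatHalf f) TriD :=
  (hf.comp continuousOn_fst fun _ => fst_mem_Ico_of_mem_TriD).add
    (continuousOn_volterra hf contDiffOn_riemannKernel.continuousOn)

theorem contDiffOn_goursatHalf (hf : ContinuousOn f (Ico 0 1)) {n : ℕ}
    (hfn : ContDiffOn ℝ n f (Ioo 0 1)) : ContDiffOn ℝ n (goursatHalf f) (interior TriD) :=
  (hfn.comp contDiffOn_fst fun _ => fst_mem_Ioo_of_mem_interior_TriD).add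
    (contDiffOn_volterra hf n hfn contDiffOn_riemannKernel)

theorem goursatHalf_snd_zero (x : ℝ) : goursatHalf f (x, 0) = f x := by
  simp [goursatHalf, volterra, riemannKernel]

theorem goursatHalf_fst_zero (y : ℝ) : goursatHalf f (0, y) = f 0 := by
  simp [goursatHalf, volterra]

theorem hasDerivAt_goursatHalf_fst (hf : ContinuousOn f (Ico 0 1)) {x y : ℝ}
    (hp : (x, y) ∈ interior TriD) (hfx : DifferentiableAt ℝ f x) :
    HasDerivAt (fun t => goursatHalf f (t, y)) (deriv f x + (volterra f (kernelX riemannKernel)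
      (x, y) + riemannKernel ((x, y), x) * f x)) x :=
  hfx.hasDerivAt.add (hasFDerivAt_volterra hf contDiffOn_riemannKernel hp).hasDerivAt_fst_slice

theorem hasDerivAt_goursatHalf_snd (hf : ContinuousOn f (Ico 0 1)) {x y : ℝ}
    (hp : (x, y) ∈ interior TriD) :
    HasDerivAt (fun t => goursatHalf f (x, t)) (volterra f (kernelY riemannKernel) (x, y)) y :=
  (hasFDerivAt_volterra hf contDiffOn_riemannKernel hp).hasDerivAt_snd_slice.const_add (f x)

theorem hasDerivAt_volterra_kernelY_riemannKernel (hf : ContinuousOn f (Ico 0 1)) {x y : ℝ}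
    (hp : (x, y) ∈ interior TriD) :
    HasDerivAt (fun t => volterra f (kernelY riemannKernel) (t, y))
      (-(1 / (4 * (1 - x - y) ^ 2)) * goursatHalf f (x, y)) x := by
  have hD : (x, y) ∈ TriD := interior_subset hp
  refine (hasFDerivAt_volterra hf contDiffOn_kernelY_riemannKernel
    hp).hasDerivAt_fst_slice.congr_deriv ?_
  have h : volterra f (kernelX (kernelY riemannKernel)) (x, y) =
      -(1 / (4 * (1 - x - y) ^ 2)) * volterra f riemannKernel (x, y) := by
    rw [volterra, volterra, ← intervalIntegral.integral_const_mul]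
    refine intervalIntegral.integral_congr fun s hs => ?_
    rw [uIcc_of_le hD.1] at hs
    simp only [kernelX_kernelY_riemannKernel (mem_kernelDomain_of_mem_TriD hD hs.2), mul_assoc]
  have hdiag := kernelY_riemannKernel_diag hD
  dsimp only at hdiag
  rw [h, hdiag, goursatHalf]
  ring

end GoursatHalf

theorem EDData.mul_sqrt {n : ℕ} {α : ℝ} (hn : 1 ≤ n) (hα : 0 ≤ α) {V0 : ℝ → ℝ}
    (h : EDData n α V0) : EDData n α (fun x => V0 x * √(1 - x)) := by
  obtain ⟨hc, hd, ⟨g, hg, hg'⟩, h0⟩ := h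
  have hne : ∀ x ∈ Ico (0 : ℝ) 1, √(1 - x) ≠ 0 := fun x hx =>
    (Real.sqrt_pos.2 (sub_pos.2 hx.2)).ne'
  refine ⟨hc.mul (by fun_prop), hd.mul (ContDiffOn.sqrt (by fun_prop) fun x hx =>
      (sub_pos.2 hx.2).ne'),
    ⟨fun x => g x * √(1 - x) - x ^ α * V0 x / (2 * √(1 - x)), ?_, fun x hx => ?_⟩, by simp [h0]⟩
  · exact (hg.mul (by fun_prop)).sub (((Real.continuous_rpow_const hα).continuousOn.mul hc).div
      (by fun_prop) fun x hx => mul_ne_zero two_ne_zero (hne x hx))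
  · have hV : HasDerivAt V0 (deriv V0 x) x :=
      ((hd.differentiableOn (by exact_mod_cast (by lia : n ≠ 0))).differentiableAt
        (isOpen_Ioo.mem_nhds hx)).hasDerivAt
    have hs : HasDerivAt (fun t => √(1 - t)) (-1 / (2 * √(1 - x))) x :=
      ((hasDerivAt_id x).const_sub 1).sqrt (sub_pos.2 hx.2).ne'
    have hVs : deriv (fun t => V0 t * √(1 - t)) x = _ := (hV.mul hs).deriv
    simp only [hVs, hg' x hx]
    have := hne x ⟨hx.1.le, hx.2⟩
    field_simp
    ring

/-- The solution of the Goursat problem whose data on the axis `x = 0` vanish. -/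
theorem exists_edSolutionWith_zero {n : ℕ} (hn : 2 ≤ n) {α : ℝ} (hα : 0 ≤ α) {V0 : ℝ → ℝ}
    (h : EDData n α V0) : ∃ V, EDSolutionWith n α V V0 0 := by
  obtain ⟨hf, hfn, ⟨g, hg, hg'⟩, hf0⟩ := h.mul_sqrt (by lia) hα
  set f : ℝ → ℝ := fun x => V0 x * √(1 - x) with hf_def
  have hpos : ∀ p ∈ TriD, 0 < 1 - p.1 - p.2 := fun p hp => by linarith [hp.2.2]
  have hsqrt : ∀ p ∈ TriD, √(1 - p.1 - p.2) ≠ 0 := fun p hp => (Real.sqrt_pos.2 (hpos p hp)).ne'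
  have hμ : ContinuousOn (fun p : ℝ × ℝ => (√(1 - p.1 - p.2))⁻¹) TriD :=
    ContinuousOn.inv₀ (by fun_prop) hsqrt
  have hμx : ∀ x y, (x, y) ∈ TriD → HasDerivAt (fun t => (√(1 - t - y))⁻¹)
      ((√(1 - x - y))⁻¹ / (2 * (1 - x - y))) x := fun x y hp =>
    (((hasDerivAt_id x).const_sub 1).sub_const y).inv_sqrt (hpos _ hp)
  have hμy : ∀ x y, (x, y) ∈ TriD → HasDerivAt (fun t => (√(1 - x - t))⁻¹)
      ((√(1 - x - y))⁻¹ / (2 * (1 - x - y))) y := fun x y hp =>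
    ((hasDerivAt_id y).const_sub (1 - x)).inv_sqrt (hpos _ hp)
  set Ux : ℝ × ℝ → ℝ := fun p => deriv f p.1 + (volterra f (kernelX riemannKernel) p +
    riemannKernel (p, p.1) * f p.1) with hUx_def
  set Uy : ℝ × ℝ → ℝ := volterra f (kernelY riemannKernel) with hUy_def
  set V : ℝ → ℝ → ℝ := fun x y => goursatHalf f (x, y) * (√(1 - x - y))⁻¹ with hV_def
  have hfx : ∀ x y, (x, y) ∈ interior TriD → DifferentiableAt ℝ f x := fun x y hp =>
    (hfn.differentiableOn (by exact_mod_cast (by lia : n ≠ 0))).differentiableAt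
      (isOpen_Ioo.mem_nhds (fst_mem_Ioo_of_mem_interior_TriD hp))
  have hVx : ∀ p ∈ interior TriD, HasDerivAt (fun t => V t p.2)
      ((Ux p + goursatHalf f p / (2 * (1 - p.1 - p.2))) * (√(1 - p.1 - p.2))⁻¹) p.1 := by
    rintro ⟨x, y⟩ hp
    refine ((hasDerivAt_goursatHalf_fst hf hp (hfx x y hp)).mul
      (hμx x y (interior_subset hp))).congr_deriv ?_
    ring
  have hVy : ∀ p ∈ interior TriD, HasDerivAt (fun t => V p.1 t)
      ((Uy p + goursatHalf f p / (2 * (1 - p.1 - p.2))) * (√(1 - p.1 - p.2))⁻¹) p.2 := by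
    rintro ⟨x, y⟩ hp
    refine ((hasDerivAt_goursatHalf_snd hf hp).mul (hμy x y (interior_subset hp))).congr_deriv ?_
    ring
  have hED : ∀ p ∈ interior TriD, EulerDarbouxAt V p.1 p.2 := by
    rintro ⟨x, y⟩ hp
    have hd : 0 < 1 - x - y := hpos _ (interior_subset hp)
    have hd' : HasDerivAt (fun t => 2 * (1 - t - y)) (2 * -1) x :=
      (((hasDerivAt_id x).const_sub 1).sub_const y).const_mul 2
    have hxy : pdxyR V x y = _ :=
      ((((hasDerivAt_volterra_kernelY_riemannKernel hf hp).add
        ((hasDerivAt_goursatHalf_fst hf hp (hfx x y hp)).div hd' (by positivity))).mul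
          (hμx x y (interior_subset hp))).congr_of_eventuallyEq
        ((isOpen_interior.eventually_mem_fst_slice hp).mono fun t ht => (hVy _ ht).deriv)).deriv
    have hx : pdxR V x y = _ := (hVx _ hp).deriv
    have hy : pdyR V x y = _ := (hVy _ hp).deriv
    dsimp only at hx hy ⊢
    rw [EulerDarbouxAt, hxy, hx, hy]
    simp only [hUx_def, hUy_def, Pi.add_apply, Pi.div_apply]
    generalize 1 - x - y = d at *
    have := (Real.sqrt_pos.2 hd).ne'
    field_simp
    ring
  have hgx : ContinuousOn (fun p : ℝ × ℝ => ((g p.1 + p.1 ^ α *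
      (volterra f (kernelX riemannKernel) p + riemannKernel (p, p.1) * f p.1)) +
        p.1 ^ α * (goursatHalf f p / (2 * (1 - p.1 - p.2)))) * (√(1 - p.1 - p.2))⁻¹) TriD := by
    have hα' : ContinuousOn (fun p : ℝ × ℝ => p.1 ^ α) TriD :=
      ((Real.continuous_rpow_const hα).comp continuous_fst).continuousOn
    have hfst : MapsTo Prod.fst TriD (Ico (0 : ℝ) 1) := fun _ => fst_mem_Ico_of_mem_TriD
    have hdiag : ContinuousOn (fun p : ℝ × ℝ => riemannKernel (p, p.1)) TriD :=
      contDiffOn_riemannKernel.continuousOn.comp (by fun_prop)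
        fun _ hp => mem_kernelDomain_of_mem_TriD hp le_rfl
    refine (((hg.comp continuousOn_fst hfst).add (hα'.mul ((continuousOn_volterra hf
      contDiffOn_kernelX_riemannKernel.continuousOn).add (hdiag.mul
        (hf.comp continuousOn_fst hfst))))).add (hα'.mul ?_)).mul hμ
    exact (continuousOn_goursatHalf hf).div (by fun_prop) fun p hp =>
      mul_ne_zero two_ne_zero (hpos p hp).ne'
  have hgy : ContinuousOn (fun p : ℝ × ℝ => p.2 ^ α *
      ((Uy p + goursatHalf f p / (2 * (1 - p.1 - p.2))) * (√(1 - p.1 - p.2))⁻¹)) TriD :=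
    ((Real.continuous_rpow_const hα).comp continuous_snd).continuousOn.mul
      (((continuousOn_volterra hf contDiffOn_kernelY_riemannKernel.continuousOn).add
        ((continuousOn_goursatHalf hf).div (by fun_prop) fun p hp =>
          mul_ne_zero two_ne_zero (hpos p hp).ne')).mul hμ)
  have hgx' : ∀ p ∈ interior TriD, ((g p.1 + p.1 ^ α *
      (volterra f (kernelX riemannKernel) p + riemannKernel (p, p.1) * f p.1)) +
        p.1 ^ α * (goursatHalf f p / (2 * (1 - p.1 - p.2)))) * (√(1 - p.1 - p.2))⁻¹ =
      p.1 ^ α * pdxR V p.1 p.2 := fun p hp => by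
    rw [pdxR, (hVx p hp).deriv, hg' _ (fst_mem_Ioo_of_mem_interior_TriD hp)]
    ring
  have hgy' : ∀ p ∈ interior TriD, p.2 ^ α *
      ((Uy p + goursatHalf f p / (2 * (1 - p.1 - p.2))) * (√(1 - p.1 - p.2))⁻¹) =
      p.2 ^ α * pdyR V p.1 p.2 := fun p hp => by
    rw [pdyR, (hVy p hp).deriv]
  refine ⟨V, (continuousOn_goursatHalf hf).mul hμ, (contDiffOn_goursatHalf hf hfn).mul
    (ContDiffOn.inv (ContDiffOn.sqrt (by fun_prop) fun p hp => (hpos p (interior_subset hp)).ne')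
      fun p hp => hsqrt p (interior_subset hp)), hED, ⟨_, hgx, hgx'⟩, ⟨_, hgy, hgy'⟩,
    ⟨_, ((((Real.continuous_rpow_const hα).comp continuous_snd).continuousOn.mul hgx).add
      (((Real.continuous_rpow_const hα).comp continuous_fst).continuousOn.mul hgy)).div
        (g := fun p : ℝ × ℝ => 2 * (1 - p.1 - p.2)) (by fun_prop)
          fun p hp => mul_ne_zero two_ne_zero (hpos p hp).ne', fun p hp => ?_⟩,
    fun x hx => ?_, fun y _ => ?_⟩
  · have h := hED p hp
    rw [EulerDarbouxAt, sub_eq_zero] at h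
    simp only [Pi.div_apply, Pi.add_apply, Pi.mul_apply, Function.comp_apply]
    rw [hgx' p hp, hgy' p hp, h]
    ring
  · have := (Real.sqrt_pos.2 (sub_pos.2 hx.2)).ne'
    simp only [hV_def, goursatHalf_snd_zero, hf_def, sub_zero]
    field_simp
  · simp only [hV_def, goursatHalf_fst_zero, hf0, zero_mul, Pi.zero_apply]

/-- A function on a rectangle whose mixed second derivative is nonpositive has a nonpositive
second difference. -/
theorem second_difference_nonpos {F Fy Fxy : ℝ → ℝ → ℝ} {X Y : ℝ} (hX : 0 < X) (hY : 0 ≤ Y)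
    (hF : ContinuousOn (fun p : ℝ × ℝ => F p.1 p.2) (Icc 0 X ×ˢ Icc 0 Y))
    (hFy : ∀ x ∈ Ioc 0 X, ∀ y ∈ Ioc 0 Y, HasDerivAt (fun t => F x t) (Fy x y) y)
    (hFxy : ∀ x ∈ Ioc 0 X, ∀ y ∈ Ioc 0 Y, HasDerivAt (fun t => Fy t y) (Fxy x y) x)
    (hle : ∀ x ∈ Ioc 0 X, ∀ y ∈ Ioc 0 Y, Fxy x y ≤ 0) :
    F X Y - F 0 Y ≤ F X 0 - F 0 0 := by
  have hcx : ∀ y ∈ Icc 0 Y, ContinuousOn (fun t => F t y) (Icc 0 X) := fun y hy =>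
    hF.comp (f := fun t => (t, y)) (by fun_prop) fun t ht => ⟨ht, hy⟩
  have hcy : ∀ x ∈ Icc 0 X, ContinuousOn (fun t => F x t) (Icc 0 Y) := fun x hx =>
    hF.comp (f := fun t => (x, t)) (by fun_prop) fun t ht => ⟨hx, ht⟩
  have hanti : ∀ ε ∈ Ioo 0 X, ∀ y ∈ Ioc 0 Y, Fy X y ≤ Fy ε y := fun ε hε y hy => by
    have hsub : Icc ε X ⊆ Ioc 0 X := fun t ht => ⟨hε.1.trans_le ht.1, ht.2⟩
    refine antitoneOn_of_deriv_nonpos (convex_Icc ε X)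
      (fun t ht => (hFxy t (hsub ht) y hy).continuousAt.continuousWithinAt)
      (fun t ht => (hFxy t (hsub (interior_subset ht)) y
        hy).differentiableAt.differentiableWithinAt)
      (fun t ht => ?_) (left_mem_Icc.2 hε.2.le) (right_mem_Icc.2 hε.2.le) hε.2.le
    rw [(hFxy t (hsub (interior_subset ht)) y hy).deriv]
    exact hle t (hsub (interior_subset ht)) y hy
  have hdiff : ∀ ε ∈ Ioo 0 X, F X Y - F ε Y ≤ F X 0 - F ε 0 := fun ε hε => by
    have hd : ∀ t ∈ interior (Icc 0 Y), HasDerivAt (fun t => F X t - F ε t)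
        (Fy X t - Fy ε t) t := fun t ht => by
      rw [interior_Icc] at ht
      exact (hFy X ⟨hX, le_rfl⟩ t ⟨ht.1, ht.2.le⟩).sub (hFy ε ⟨hε.1, hε.2.le⟩ t ⟨ht.1, ht.2.le⟩)
    refine antitoneOn_of_deriv_nonpos (f := fun t => F X t - F ε t) (convex_Icc 0 Y)
      ((hcy X ⟨hX.le, le_rfl⟩).sub (hcy ε ⟨hε.1.le, hε.2.le⟩))
      (fun t ht => (hd t ht).differentiableAt.differentiableWithinAt)
      (fun t ht => ?_) (left_mem_Icc.2 hY) (right_mem_Icc.2 hY) hY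
    rw [(hd t ht).deriv]
    rw [interior_Icc] at ht
    exact sub_nonpos.2 (hanti ε hε t ⟨ht.1, ht.2.le⟩)
  have hcl : closure (Ioo 0 X) = Icc 0 X := closure_Ioo hX.ne
  refine le_on_closure (f := fun ε => F X Y - F ε Y) (g := fun ε => F X 0 - F ε 0) hdiff ?_ ?_
    (hcl ▸ left_mem_Icc.2 hX.le)
  · rw [hcl]
    exact continuousOn_const.sub (hcx Y ⟨hY, le_rfl⟩)
  · rw [hcl]
    exact continuousOn_const.sub (hcx 0 ⟨le_rfl, hY⟩)

/-- Uniqueness for the Goursat problem of a linear hyperbolic equation without first order terms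
on a rectangle. -/
theorem eq_zero_of_abs_mixed_deriv_le {Z Zy Zxy : ℝ → ℝ → ℝ} {X Y C : ℝ} (hX : 0 ≤ X) (hY : 0 ≤ Y)
    (hC : 0 ≤ C) (hZ : ContinuousOn (fun p : ℝ × ℝ => Z p.1 p.2) (Icc 0 X ×ˢ Icc 0 Y))
    (hZy : ∀ x ∈ Ioc 0 X, ∀ y ∈ Ioc 0 Y, HasDerivAt (fun t => Z x t) (Zy x y) y)
    (hZxy : ∀ x ∈ Ioc 0 X, ∀ y ∈ Ioc 0 Y, HasDerivAt (fun t => Zy t y) (Zxy x y) x)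
    (hle : ∀ x ∈ Ioc 0 X, ∀ y ∈ Ioc 0 Y, |Zxy x y| ≤ C * |Z x y|)
    (hx0 : ∀ x ∈ Icc 0 X, Z x 0 = 0) (hy0 : ∀ y ∈ Icc 0 Y, Z 0 y = 0) : Z X Y = 0 := by
  set l : ℝ := C + 1 with hl
  have hlpos : 0 < l := by positivity
  obtain ⟨⟨x₀, y₀⟩, ⟨hx₀, hy₀⟩, hmax⟩ := (isCompact_Icc.prod isCompact_Icc).exists_isMaxOn
    ⟨(X, Y), ⟨hX, le_rfl⟩, ⟨hY, le_rfl⟩⟩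
    (hZ.abs.mul (by fun_prop : Continuous fun p : ℝ × ℝ =>
      Real.exp (-(l * (p.1 + p.2)))).continuousOn)
  set B : ℝ := |Z x₀ y₀| * Real.exp (-(l * (x₀ + y₀))) with hB
  have hB0 : 0 ≤ B := by positivity
  have hbound : ∀ x ∈ Icc 0 X, ∀ y ∈ Icc 0 Y, |Z x y| ≤ B * Real.exp (l * (x + y)) :=
    fun x hx y hy => by
      have h : |Z x y| * Real.exp (-(l * (x + y))) ≤ B :=
        hmax (show (x, y) ∈ Icc 0 X ×ˢ Icc 0 Y from ⟨hx, hy⟩)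
      rwa [Real.exp_neg, ← div_eq_mul_inv, div_le_iff₀ (Real.exp_pos _)] at h
  suffices hBz : B ≤ 0 by
    have h := hbound X ⟨hX, le_rfl⟩ Y ⟨hY, le_rfl⟩
    rw [le_antisymm hBz hB0, zero_mul] at h
    exact abs_nonpos_iff.1 h
  dsimp only at hx₀ hy₀
  rcases hx₀.1.eq_or_lt with h | hx₀pos
  · simp [hB, ← h, hy0 y₀ hy₀]
  set K : ℝ := B * C / l ^ 2 with hK
  have hK0 : 0 ≤ K := by positivity
  have hKl : K * l ^ 2 = B * C := by rw [hK]; field_simp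
  have hKB : K ≤ B / 2 := by
    rw [hK, div_le_iff₀ (by positivity)]
    nlinarith [mul_nonneg hB0 (sq_nonneg C)]
  have hexp : ∀ c x y : ℝ, HasDerivAt (fun t => c * Real.exp (l * (x + t)))
      (c * l * Real.exp (l * (x + y))) y := fun c x y => by
    refine ((((hasDerivAt_id y).const_add x).const_mul l).exp.const_mul c).congr_deriv ?_
    simp only [id]
    ring
  have hexp' : ∀ c x y : ℝ, HasDerivAt (fun t => c * Real.exp (l * (t + y)))
      (c * l * Real.exp (l * (x + y))) x := fun c x y => by
    simpa only [add_comm y] using hexp c y x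
  have hxsub : Icc 0 x₀ ⊆ Icc 0 X := Icc_subset_Icc_right hx₀.2
  have hysub : Icc 0 y₀ ⊆ Icc 0 Y := Icc_subset_Icc_right hy₀.2
  have hxsub' : Ioc 0 x₀ ⊆ Ioc 0 X := Ioc_subset_Ioc_right hx₀.2
  have hysub' : Ioc 0 y₀ ⊆ Ioc 0 Y := Ioc_subset_Ioc_right hy₀.2
  have hsigned : ∀ σ : ℝ, |σ| = 1 → σ * Z x₀ y₀ ≤ K * Real.exp (l * (x₀ + y₀)) := fun σ hσ => by
    have h := second_difference_nonpos (F := fun x y => σ * Z x y - K * Real.exp (l * (x + y)))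
      (Fy := fun x y => σ * Zy x y - K * l * Real.exp (l * (x + y)))
      (Fxy := fun x y => σ * Zxy x y - K * l * l * Real.exp (l * (x + y))) hx₀pos hy₀.1
      ((continuousOn_const.mul (hZ.mono (prod_mono hxsub hysub))).sub
        (by fun_prop : Continuous fun p : ℝ × ℝ => K * Real.exp (l * (p.1 + p.2))).continuousOn)
      (fun x hx y hy => ((hZy x (hxsub' hx) y (hysub' hy)).const_mul σ).sub (hexp K x y))
      (fun x hx y hy => ((hZxy x (hxsub' hx) y (hysub' hy)).const_mul σ).sub (hexp' (K * l) x y))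
      (fun x hx y hy => by
        have h1 := hle x (hxsub' hx) y (hysub' hy)
        have h2 := hbound x (Ioc_subset_Icc_self (hxsub' hx)) y (Ioc_subset_Icc_self (hysub' hy))
        have h3 : σ * Zxy x y ≤ |Zxy x y| := by
          simpa [abs_mul, hσ] using le_abs_self (σ * Zxy x y)
        have h4 := mul_le_mul_of_nonneg_left h2 hC
        have h5 : K * l * l * Real.exp (l * (x + y)) = C * (B * Real.exp (l * (x + y))) := by
          linear_combination Real.exp (l * (x + y)) * hKl
        linarith)
    have hmono : K * Real.exp (l * (0 + 0)) ≤ K * Real.exp (l * (0 + y₀)) := by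
      gcongr
      exact hy₀.1
    have hpos : 0 ≤ K * Real.exp (l * (x₀ + 0)) := by positivity
    rw [hy0 y₀ hy₀, hx0 x₀ hx₀, hx0 0 ⟨le_rfl, hX⟩] at h
    linarith
  have h1 := hsigned 1 (by simp)
  have h2 := hsigned (-1) (by simp)
  have h3 : |Z x₀ y₀| ≤ K * Real.exp (l * (x₀ + y₀)) := abs_le.2 ⟨by linarith, by linarith⟩
  have h4 : B ≤ K := by
    rwa [hB, Real.exp_neg, ← div_eq_mul_inv, div_le_iff₀ (Real.exp_pos _)]
  linarith

/-- A solution of the Euler–Darboux equation with vanishing Goursat data vanishes. -/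
theorem eulerDarboux_eq_zero {V : ℝ → ℝ → ℝ}
    (hVc : ContinuousOn (fun p : ℝ × ℝ => V p.1 p.2) TriD)
    (hVd : ContDiffOn ℝ 2 (fun p : ℝ × ℝ => V p.1 p.2) (interior TriD))
    (hVe : ∀ p ∈ interior TriD, EulerDarbouxAt V p.1 p.2)
    (hV0 : ∀ x ∈ Ico (0 : ℝ) 1, V x 0 = 0) (hV1 : ∀ y ∈ Ico (0 : ℝ) 1, V 0 y = 0)
    {p : ℝ × ℝ} (hp : p ∈ TriD) : V p.1 p.2 = 0 := by
  obtain ⟨X, Y⟩ := p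
  obtain ⟨hX, hY, hXY⟩ := hp
  dsimp only at hX hY hXY ⊢
  have hVd1 : ContDiffOn ℝ 1 (fun p : ℝ × ℝ => V p.1 p.2) (interior TriD) :=
    hVd.of_le (by norm_num)
  have hR : Icc 0 X ×ˢ Icc 0 Y ⊆ TriD := fun p hp =>
    ⟨hp.1.1, hp.2.1, by linarith [hp.1.2, hp.2.2]⟩
  have hR' : ∀ x ∈ Ioc 0 X, ∀ y ∈ Ioc 0 Y, (x, y) ∈ interior TriD := fun x hx y hy => by
    rw [interior_TriD]
    exact ⟨hx.1, hy.1, by dsimp only; linarith [hx.2, hy.2]⟩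
  have hd : ∀ x ∈ Ioc 0 X, ∀ y ∈ Ioc 0 Y, 0 < 1 - x - y := fun x hx y hy => by
    linarith [hx.2, hy.2]
  have hXY' : 0 < 1 - X - Y := by linarith
  have hZ := eq_zero_of_abs_mixed_deriv_le (Z := fun x y => √(1 - x - y) * V x y)
    (Zy := fun x y => √(1 - x - y) * pdyR V x y - (√(1 - x - y))⁻¹ / 2 * V x y)
    (Zxy := fun x y => -(1 / (4 * (1 - x - y) ^ 2)) * (√(1 - x - y) * V x y))
    (C := 1 / (4 * (1 - X - Y) ^ 2)) hX hY (by positivity)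
    (ContinuousOn.mul (by fun_prop) (hVc.mono hR)) (fun x hx y hy => ?_) (fun x hx y hy => ?_)
    (fun x hx y hy => ?_) (fun x hx => ?_) (fun y hy => ?_)
  · exact (mul_eq_zero.1 hZ).resolve_left (Real.sqrt_pos.2 hXY').ne'
  · have h := hd x hx y hy
    refine ((((hasDerivAt_id y).const_sub (1 - x)).sqrt h.ne').mul
      (hasDerivAt_pdyR isOpen_interior hVd1 (hR' x hx y hy))).congr_deriv ?_
    simp only [id]
    have := (Real.sqrt_pos.2 h).ne'
    field_simp
    ring
  · have h := hd x hx y hy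
    have hd' : HasDerivAt (fun t => 1 - t - y) (-1) x :=
      ((hasDerivAt_id x).const_sub 1).sub_const y
    refine (((hd'.sqrt h.ne').mul (hasDerivAt_pdxyR isOpen_interior hVd (hR' x hx y hy))).sub
      (((hd'.inv_sqrt h).div_const 2).mul
        (hasDerivAt_pdxR isOpen_interior hVd1 (hR' x hx y hy)))).congr_deriv ?_
    have hE := hVe _ (hR' x hx y hy)
    rw [EulerDarbouxAt, sub_eq_zero] at hE
    dsimp only at hE
    rw [hE]
    generalize 1 - x - y = d at *
    have hs := (Real.sqrt_pos.2 h).ne'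
    obtain ⟨r, hr⟩ : ∃ r, r = √d := ⟨_, rfl⟩
    have hrd : d = r ^ 2 := by rw [hr, Real.sq_sqrt h.le]
    rw [← hr] at hs ⊢
    rw [hrd]
    field_simp
    ring
  · have h := hd x hx y hy
    rw [abs_mul, abs_neg, abs_of_pos (by positivity)]
    gcongr
    exacts [hx.2, hy.2]
  · simp only [hV0 x ⟨hx.1, by linarith [hx.2]⟩, mul_zero]
  · simp only [hV1 y ⟨hy.1, by linarith [hy.2]⟩, mul_zero]

/-- Existence and uniqueness of the C^n-solution of the Goursat problem
for the Euler–Darboux equation in D. -/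
theorem eulerDarboux_goursat_existence_uniqueness
    (n : ℕ) (hn : 2 ≤ n) (α : ℝ) (hα : α ∈ Ico (0:ℝ) 1)
    (V0 V1 : ℝ → ℝ) (hd0 : EDData n α V0) (hd1 : EDData n α V1) :
    ∃ V : ℝ → ℝ → ℝ, EDSolution n V V0 V1 ∧
      ∀ V' : ℝ → ℝ → ℝ, EDSolution n V' V0 V1 → ∀ p ∈ TriD, V' p.1 p.2 = V p.1 p.2 := by
  obtain ⟨A, hA⟩ := exists_edSolutionWith_zero hn hα.1 hd0
  obtain ⟨B, hB⟩ := exists_edSolutionWith_zero hn hα.1 hd1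
  obtain ⟨V, hV⟩ : ∃ V, EDSolutionWith n α V V0 V1 :=
    ⟨_, by simpa only [Pi.zero_apply, add_zero, zero_add] using hA.add hn (hB.swap hn)⟩
  refine ⟨V, ⟨α, hα, hV⟩, ?_⟩
  rintro V' ⟨_, _, hc', hd', he', -, -, -, h0', h1'⟩ p hp
  obtain ⟨hc, hd, he, -, -, -, h0, h1⟩ := hV
  have hd2 := hd.of_le (m := 2) (by exact_mod_cast hn)
  have hd2' := hd'.of_le (m := 2) (by exact_mod_cast hn)
  have h := eulerDarboux_eq_zero (V := fun x y => V' x y + -1 * V x y)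
    (hc'.add (continuousOn_const.mul hc)) (hd2'.add (contDiffOn_const.mul hd2))
    (fun p hp => (he' p hp).add_const_mul isOpen_interior hd2' hd2 (-1) hp (he p hp))
    (fun x hx => by simp only [h0' x hx, h0 x hx]; ring)
    (fun y hy => by simp only [h1' y hy, h1 y hy]; ring) hp
  linarith
end
end

section
/- Let n ≥ 2 be an integer and α ∈ [0,1). Let V0, V1 : [0,1) → ℝ be real-valued functions such that V0, V1 ∈ C([0,1)) ∩ C^n((0,1)); x^α V0'(x) and y^α V1'(y) extend continuously to [0,1); and V0(0) = V1(0) = 0. Then the unique C^n-solution V of the Goursat problem for the Euler–Darboux equation in D with data {V0, V1} is given for (x,y) ∈ D by the Abel-type representation V(x,y) = (1/π) ∫_0^x [√(1−k)/√((1−y−k)(x−k))] (∫_0^k V0'(x')/√(k−x') dx') dk + (1/π) ∫_{1−y}^1 [√k/√((k−(1−y))(k−x))] (∫_0^{1−k} V1'(y')/√(1−y'−k) dy') dk. -/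
open Complex Set MeasureTheory Topology Filter ComplexConjugate

noncomputable section

/-- A nonnegative derivative is integrable with the expected integral. -/
theorem integral_of_hasDerivAt_nonneg {F f : ℝ → ℝ} {a b : ℝ} (hab : a ≤ b)
    (hF : ContinuousOn F (Icc a b)) (hd : ∀ x ∈ Ioo a b, HasDerivAt F (f x) x)
    (hf : ∀ x ∈ Ioo a b, 0 ≤ f x) :
    IntervalIntegrable f volume a b ∧ ∫ x in a..b, f x = F b - F a := by
  have h : IntervalIntegrable f volume a b :=
    intervalIntegral.intervalIntegrable_deriv_of_nonneg (by rwa [uIcc_of_le hab])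
      (by simpa [hab] using hd) (by simpa [hab] using hf)
  exact ⟨h, intervalIntegral.integral_eq_sub_of_hasDerivAt_of_le hab hF hd h⟩

theorem integral_one_div_sqrt_mul_sqrt {b c : ℝ} (hbc : b < c) :
    IntervalIntegrable (fun k => 1 / (√(k - b) * √(c - k))) volume b c ∧
      ∫ k in b..c, 1 / (√(k - b) * √(c - k)) = Real.pi := by
  have hc : 0 < c - b := sub_pos.2 hbc
  have key := integral_of_hasDerivAt_nonneg (F := fun k => Real.arcsin ((2 * k - b - c) / (c - b)))
    (f := fun k => 1 / (√(k - b) * √(c - k))) hbc.le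
    (Real.continuous_arcsin.comp (by fun_prop)).continuousOn ?_ (fun x _ => by positivity)
  · refine ⟨key.1, key.2.trans ?_⟩
    have h1 : (2 * c - b - c) / (c - b) = 1 := by field_simp; ring
    have h2 : (2 * b - b - c) / (c - b) = -1 := by field_simp; ring
    simp only [h1, h2, Real.arcsin_one, Real.arcsin_neg_one]
    ring
  · intro k hk
    have h1 : 0 < k - b := sub_pos.2 hk.1
    have h2 : 0 < c - k := sub_pos.2 hk.2
    have hw : HasDerivAt (fun k => (2 * k - b - c) / (c - b)) (2 / (c - b)) k := by
      simpa using ((((hasDerivAt_id k).const_mul 2).sub_const b).sub_const c).div_const (c - b)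
    have e : 1 - ((2 * k - b - c) / (c - b)) ^ 2 = (2 / (c - b)) ^ 2 * ((k - b) * (c - k)) := by
      field_simp; ring
    have hpos : 0 < 1 - ((2 * k - b - c) / (c - b)) ^ 2 := by rw [e]; positivity
    have := (Real.hasDerivAt_arcsin (x := (2 * k - b - c) / (c - b))
      (by rintro h; rw [h] at hpos; norm_num at hpos)
      (by rintro h; rw [h] at hpos; norm_num at hpos)).comp k hw
    refine this.congr_deriv ?_
    rw [e, Real.sqrt_mul (by positivity), Real.sqrt_sq (by positivity), Real.sqrt_mul h1.le]
    have := Real.sqrt_pos.2 h1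
    have := Real.sqrt_pos.2 h2
    field_simp

theorem integral_one_div_sub_mul_sqrt_mul_sqrt {s b c : ℝ} (hsb : s < b) (hbc : b < c) :
    IntervalIntegrable (fun k => 1 / ((k - s) * (√(k - b) * √(c - k)))) volume b c ∧
      ∫ k in b..c, 1 / ((k - s) * (√(k - b) * √(c - k))) =
        Real.pi / (√(b - s) * √(c - s)) := by
  have hc : 0 < c - b := sub_pos.2 hbc
  have hb : 0 < b - s := sub_pos.2 hsb
  have hcs : 0 < c - s := by linarith
  set w : ℝ → ℝ := fun k => (2 * ((b - s) * (c - s)) / (k - s) - (b - s) - (c - s)) / (c - b)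
    with hwdef
  have key := integral_of_hasDerivAt_nonneg
    (F := fun k => -(Real.arcsin (w k)) / (√(b - s) * √(c - s)))
    (f := fun k => 1 / ((k - s) * (√(k - b) * √(c - k)))) hbc.le ?_ ?_ ?_
  · refine ⟨key.1, key.2.trans ?_⟩
    have h1 : w c = -1 := by simp only [hwdef]; field_simp; ring
    have h2 : w b = 1 := by simp only [hwdef]; field_simp; ring
    simp only [h1, h2, Real.arcsin_one, Real.arcsin_neg_one]
    ring
  · refine ContinuousOn.div_const (ContinuousOn.neg (Real.continuous_arcsin.comp_continuousOn ?_)) _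
    refine ContinuousOn.div_const (ContinuousOn.sub (ContinuousOn.sub (ContinuousOn.div
      continuousOn_const (by fun_prop) ?_) continuousOn_const) continuousOn_const) _
    intro k hk
    have := hk.1
    exact (by linarith : 0 < k - s).ne'
  · intro k hk
    have h1 : 0 < k - b := sub_pos.2 hk.1
    have h2 : 0 < c - k := sub_pos.2 hk.2
    have h3 : 0 < k - s := by linarith
    have hw : HasDerivAt w (-(2 * ((b - s) * (c - s)) / (k - s) ^ 2) / (c - b)) k := by
      have := (((((hasDerivAt_id k).sub_const s).inv h3.ne').const_mul
        (2 * ((b - s) * (c - s)))).sub_const (b - s)).sub_const (c - s) |>.div_const (c - b)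
      refine this.congr_deriv ?_
      simp only [id]
      ring
    have e : 1 - w k ^ 2 =
        (2 / ((k - s) * (c - b))) ^ 2 * (((b - s) * (c - s)) * ((k - b) * (c - k))) := by
      simp only [hwdef]; field_simp; ring
    have hpos : 0 < 1 - w k ^ 2 := by rw [e]; positivity
    have := ((Real.hasDerivAt_arcsin (x := w k)
      (by rintro h; rw [h] at hpos; norm_num at hpos)
      (by rintro h; rw [h] at hpos; norm_num at hpos)).comp k hw).neg.div_const
        (√(b - s) * √(c - s))
    refine this.congr_deriv ?_
    rw [e, Real.sqrt_mul (by positivity), Real.sqrt_sq (by positivity), Real.sqrt_mul (by positivity),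
      Real.sqrt_mul h1.le, Real.sqrt_mul hb.le]
    have := Real.sqrt_pos.2 h1
    have := Real.sqrt_pos.2 h2
    have := Real.sqrt_pos.2 hb
    have := Real.sqrt_pos.2 hcs
    have e1 : √(b - s) ^ 2 = b - s := Real.sq_sqrt hb.le
    have e2 : √(c - s) ^ 2 = c - s := Real.sq_sqrt hcs.le
    field_simp
    rw [e1, e2]
  · intro k hk
    have h3 : 0 < k - s := by linarith [hk.1]
    positivity

theorem integral_one_div_sub_mul_sqrt_mul_sqrt' {s b c : ℝ} (hbc : b < c) (hcs : c < s) :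
    IntervalIntegrable (fun k => 1 / ((s - k) * (√(k - b) * √(c - k)))) volume b c ∧
      ∫ k in b..c, 1 / ((s - k) * (√(k - b) * √(c - k))) =
        Real.pi / (√(s - b) * √(s - c)) := by
  obtain ⟨h1, h2⟩ := integral_one_div_sub_mul_sqrt_mul_sqrt (neg_lt_neg hcs) (neg_lt_neg hbc)
  have e : ∀ k : ℝ, 1 / ((-k - -s) * (√(-k - -c) * √(-b - -k))) =
      1 / ((s - k) * (√(k - b) * √(c - k))) := by
    intro k
    rw [mul_comm √(-k - -c)]
    ring_nf
  constructor
  · have := (IntervalIntegrable.iff_comp_neg enorm_ne_top).1 h1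
    simp only [neg_neg, e] at this
    exact this.symm
  · have := intervalIntegral.integral_comp_neg (a := b) (b := c)
      (fun k => 1 / ((k - -s) * (√(k - -c) * √(-b - k))))
    rw [h2] at this
    simp only [e] at this
    rw [this, mul_comm √(s - b)]
    ring_nf

theorem kernel_integral_swap {a b c d C : ℝ} (hab : a ≤ b) (hcd : c ≤ d) {K : ℝ → ℝ → ℝ}
    {f w : ℝ → ℝ} (hK : Measurable (Function.uncurry K))
    (hK0 : ∀ k ∈ Ioo a b, ∀ s ∈ Ioo c d, 0 ≤ K k s)
    (hKi : ∀ s ∈ Ioo c d, IntervalIntegrable (fun k => K k s) volume a b)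
    (hw : ∀ s ∈ Ioo c d, ∫ k in a..b, K k s = w s) (hC : ∀ s ∈ Ioo c d, w s ≤ C)
    (hf : IntervalIntegrable f volume c d) :
    IntervalIntegrable (fun k => ∫ s in c..d, K k s * f s) volume a b ∧
      IntervalIntegrable (fun s => w s * f s) volume c d ∧
      ∫ k in a..b, ∫ s in c..d, K k s * f s = ∫ s in c..d, w s * f s := by
  have hii : ∀ {a b : ℝ}, a ≤ b → ∀ g : ℝ → ℝ, IntervalIntegrable g volume a b ↔
      Integrable g (volume.restrict (Ioo a b)) := fun h g =>
    intervalIntegrable_iff_integrableOn_Ioo_of_le h enorm_ne_top enorm_ne_top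
  simp only [hii hab, hii hcd, intervalIntegral.integral_of_le hab,
    intervalIntegral.integral_of_le hcd, integral_Ioc_eq_integral_Ioo] at *
  have hm : AEStronglyMeasurable (fun p : ℝ × ℝ => K p.1 p.2 * f p.2)
      ((volume.restrict (Ioo a b)).prod (volume.restrict (Ioo c d))) :=
    hK.aestronglyMeasurable.mul hf.aestronglyMeasurable.comp_snd
  have hI : Integrable (Function.uncurry fun k s => K k s * f s)
      ((volume.restrict (Ioo a b)).prod (volume.restrict (Ioo c d))) := by
    refine (integrable_prod_iff' hm).2 ⟨?_, ?_⟩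
    · filter_upwards [ae_restrict_mem measurableSet_Ioo] with s hs
      exact (hKi s hs).mul_const _
    · refine Integrable.mono' (hf.norm.const_mul C) hm.norm.prod_swap.integral_prod_right' ?_
      filter_upwards [ae_restrict_mem measurableSet_Ioo] with s hs
      have e : ∫ k in Ioo a b, ‖K k s * f s‖ = w s * ‖f s‖ := by
        rw [← hw s hs, ← integral_mul_const]
        refine setIntegral_congr_fun measurableSet_Ioo fun k hk => ?_
        simp only [norm_mul, Real.norm_of_nonneg (hK0 k hk s hs)]
      have e0 : 0 ≤ ∫ k in Ioo a b, ‖K k s * f s‖ := integral_nonneg fun _ => norm_nonneg _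
      rw [Real.norm_of_nonneg e0, e]
      exact mul_le_mul_of_nonneg_right (hC s hs) (norm_nonneg _)
  have e : EqOn (fun s => ∫ k in Ioo a b, K k s * f s) (fun s => w s * f s) (Ioo c d) :=
    fun s hs => by simp only [integral_mul_const, hw s hs]
  exact ⟨hI.integral_prod_left, IntegrableOn.congr_fun hI.integral_prod_right e measurableSet_Ioo,
    (integral_integral_swap hI).trans (setIntegral_congr_fun measurableSet_Ioo e)⟩

theorem integral_eq_of_zero_right {f : ℝ → ℝ} {a b c : ℝ} (hab : a ≤ b) (hbc : b ≤ c)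
    (h : ∀ x ∈ Ioc b c, f x = 0) : ∫ x in a..c, f x = ∫ x in a..b, f x := by
  rw [intervalIntegral.integral_of_le hab, intervalIntegral.integral_of_le (hab.trans hbc)]
  exact setIntegral_eq_of_subset_of_forall_sdiff_eq_zero measurableSet_Ioc
    (Ioc_subset_Ioc_right hbc) fun x hx => h x ⟨by
      by_contra hh
      exact hx.2 ⟨hx.1.1, not_lt.1 hh⟩, hx.1.2⟩

theorem integral_eq_of_zero_left {f : ℝ → ℝ} {a b c : ℝ} (hab : a ≤ b) (hbc : b ≤ c)
    (h : ∀ x ∈ Ioc a b, f x = 0) : ∫ x in a..c, f x = ∫ x in b..c, f x := by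
  rw [intervalIntegral.integral_of_le hbc, intervalIntegral.integral_of_le (hab.trans hbc)]
  exact setIntegral_eq_of_subset_of_forall_sdiff_eq_zero measurableSet_Ioc
    (Ioc_subset_Ioc_left hab) fun x hx => h x ⟨hx.1.1, by
      by_contra hh
      exact hx.2 ⟨not_le.1 hh, hx.1.2⟩⟩

theorem intervalIntegrable_of_zero {f : ℝ → ℝ} {b c : ℝ} (hbc : b ≤ c)
    (h : ∀ x ∈ Ioc b c, f x = 0) : IntervalIntegrable f volume b c := by
  rw [intervalIntegrable_iff_integrableOn_Ioc_of_le hbc]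
  exact integrableOn_zero.congr_fun (fun x hx => (h x hx).symm) measurableSet_Ioc

/-- Abel's inversion of the half-order integral. -/
theorem abel_integral {x : ℝ} (hx : 0 ≤ x) {f : ℝ → ℝ} (hf : IntervalIntegrable f volume 0 x) :
    IntervalIntegrable (fun k => 1 / √(x - k) * ∫ s in (0:ℝ)..k, f s / √(k - s)) volume 0 x ∧
      ∫ k in (0:ℝ)..x, 1 / √(x - k) * ∫ s in (0:ℝ)..k, f s / √(k - s) =
        Real.pi * ∫ s in (0:ℝ)..x, f s := by
  have hz : ∀ s ∈ Ioo 0 x, ∀ k ∈ Ioc 0 s, 1 / (√(k - s) * √(x - k)) = 0 := by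
    intro s hs k hk
    rw [Real.sqrt_eq_zero_of_nonpos (by linarith [hk.2])]; simp
  obtain ⟨h1, -, h2⟩ := kernel_integral_swap (K := fun k s => 1 / (√(k - s) * √(x - k)))
    (w := fun _ => Real.pi) (C := Real.pi) hx hx
    (by unfold Function.uncurry; fun_prop) (fun k _ s _ => by positivity)
    (fun s hs => (intervalIntegrable_of_zero hs.1.le (hz s hs)).trans
      (integral_one_div_sqrt_mul_sqrt hs.2).1)
    (fun s hs => (integral_eq_of_zero_left hs.1.le hs.2.le (hz s hs)).trans
      (integral_one_div_sqrt_mul_sqrt hs.2).2)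
    (fun _ _ => le_rfl) hf
  have e : ∀ k ∈ Ioc 0 x, (∫ s in (0:ℝ)..x, 1 / (√(k - s) * √(x - k)) * f s) =
      1 / √(x - k) * ∫ s in (0:ℝ)..k, f s / √(k - s) := by
    intro k hk
    rw [← intervalIntegral.integral_const_mul, integral_eq_of_zero_right hk.1.le hk.2]
    · exact intervalIntegral.integral_congr fun s _ => by ring
    · intro s hs
      rw [Real.sqrt_eq_zero_of_nonpos (by linarith [hs.1])]; simp
  rw [intervalIntegral.integral_const_mul] at h2
  rw [← uIoc_of_le hx] at e
  exact ⟨h1.congr e, by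
    rw [← h2]
    exact intervalIntegral.integral_congr_ae (ae_of_all _ fun k hk => (e k hk).symm)⟩

theorem intervalIntegrable_sqrt_div_sqrt {x : ℝ} (hx : 0 ≤ x) :
    IntervalIntegrable (fun u => √u / √(x - u)) volume 0 x := by
  rcases hx.eq_or_lt with rfl | hx
  · simp
  have := (integral_one_div_sqrt_mul_sqrt hx).1.continuousOn_mul (g := fun u => u) continuousOn_id
  refine this.congr fun u hu => ?_
  rw [uIoc_of_le hx.le] at hu
  have := Real.sqrt_pos.2 hu.1
  have e : √u * √u = u := Real.mul_self_sqrt hu.1.le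
  simp only [sub_zero]
  rcases (Real.sqrt_nonneg (x - u)).eq_or_lt with h | h
  · simp [← h]
  · field_simp; linarith

theorem integral_sqrt_div_sqrt_div_sub {x k : ℝ} (hx : 0 ≤ x) (hxk : x < k) :
    ∫ u in (0:ℝ)..x, 1 / (k - u) * (√u / √(x - u)) = Real.pi * (√k / √(k - x) - 1) := by
  have hk0 : 0 < k := hx.trans_lt hxk
  have hk : √k * √k = k := Real.mul_self_sqrt hk0.le
  have hk' := Real.sqrt_pos.2 hk0
  rcases hx.eq_or_lt with rfl | hx
  · simp [hk'.ne']
  obtain ⟨h1, h2⟩ := integral_one_div_sqrt_mul_sqrt hx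
  obtain ⟨h3, h4⟩ := integral_one_div_sub_mul_sqrt_mul_sqrt' hx hxk
  have e : ∫ u in (0:ℝ)..x, 1 / (k - u) * (√u / √(x - u)) =
      ∫ u in (0:ℝ)..x, (k * (1 / ((k - u) * (√(u - 0) * √(x - u)))) -
        1 / (√(u - 0) * √(x - u))) := by
    refine intervalIntegral.integral_congr_ae (ae_of_all _ fun u hu => ?_)
    rw [uIoc_of_le hx.le] at hu
    have := Real.sqrt_pos.2 hu.1
    have e : √u ^ 2 = u := Real.sq_sqrt hu.1.le
    have hku : 0 < k - u := by linarith [hu.2]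
    simp only [sub_zero]
    rcases (Real.sqrt_nonneg (x - u)).eq_or_lt with h | h
    · simp [← h]
    · field_simp; linarith
  rw [e, intervalIntegral.integral_sub (h3.const_mul k) h1, intervalIntegral.integral_const_mul,
    h2, h4]
  have := Real.sqrt_pos.2 (sub_pos.2 hxk)
  simp only [sub_zero]
  field_simp
  linear_combination (-1 : ℝ) * hk

theorem integral_sqrt_div_sqrt_right {x b c : ℝ} (hx : 0 ≤ x) (hxb : x < b) (hbc : b < c) :
    IntervalIntegrable (fun k => √k / √((k - b) * (k - x)) / √(c - k)) volume b c ∧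
      ∫ k in b..c, √k / √((k - b) * (k - x)) / √(c - k) =
        Real.pi + ∫ k in (0:ℝ)..x, √k / √((b - k) * (x - k)) / √(c - k) := by
  obtain ⟨h1, -, h2⟩ := kernel_integral_swap
    (K := fun k u => 1 / ((k - u) * (√(k - b) * √(c - k))))
    (f := fun u => √u / √(x - u)) (w := fun u => Real.pi / (√(b - u) * √(c - u)))
    (C := Real.pi / (√(b - x) * √(c - x))) hbc.le hx
    (by unfold Function.uncurry; fun_prop)
    (fun k hk u hu => by
      have : 0 < k - u := by linarith [hk.1, hu.2]
      positivity)
    (fun u hu => (integral_one_div_sub_mul_sqrt_mul_sqrt (hu.2.trans hxb) hbc).1)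
    (fun u hu => (integral_one_div_sub_mul_sqrt_mul_sqrt (hu.2.trans hxb) hbc).2)
    (fun u hu => by
      have h1 := Real.sqrt_pos.2 (sub_pos.2 hxb)
      have h2 := Real.sqrt_pos.2 (sub_pos.2 (hxb.trans hbc))
      have := Real.pi_pos
      have := hu.2
      gcongr)
    (intervalIntegrable_sqrt_div_sqrt hx)
  obtain ⟨h3, h4⟩ := integral_one_div_sqrt_mul_sqrt hbc
  have e : ∀ k ∈ uIoc b c, 1 / (√(k - b) * √(c - k)) + (1 / Real.pi) *
      (∫ u in (0:ℝ)..x, 1 / ((k - u) * (√(k - b) * √(c - k))) * (√u / √(x - u))) =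
        √k / √((k - b) * (k - x)) / √(c - k) := by
    intro k hk
    rw [uIoc_of_le hbc.le] at hk
    have e1 : ∫ u in (0:ℝ)..x, 1 / ((k - u) * (√(k - b) * √(c - k))) * (√u / √(x - u)) =
        ∫ u in (0:ℝ)..x, 1 / (√(k - b) * √(c - k)) * (1 / (k - u) * (√u / √(x - u))) :=
      intervalIntegral.integral_congr fun u _ => by simp only [one_div, mul_inv]; ring
    rw [e1, intervalIntegral.integral_const_mul,
      integral_sqrt_div_sqrt_div_sub hx (hxb.trans hk.1), Real.sqrt_mul (by linarith [hk.1])]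
    have := Real.pi_pos
    field_simp
    ring
  have hi := h3.add (h1.const_mul (1 / Real.pi))
  refine ⟨hi.congr e, ?_⟩
  rw [← intervalIntegral.integral_congr_ae (ae_of_all _ fun k hk => e k hk),
    intervalIntegral.integral_add h3 (h1.const_mul _), h4, intervalIntegral.integral_const_mul, h2,
    ← intervalIntegral.integral_const_mul]
  congr 1
  refine intervalIntegral.integral_congr_ae (ae_of_all _ fun k hk => ?_)
  rw [uIoc_of_le hx] at hk
  have := Real.pi_pos
  rw [Real.sqrt_mul (by linarith [hk.2])]
  simp only [div_eq_mul_inv, mul_inv]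
  field_simp

theorem integral_sqrt_div_sqrt_left_le {x b c : ℝ} (hx : 0 ≤ x) (hxb : x < b) (hbc : b ≤ c) :
    IntervalIntegrable (fun k => √k / √((b - k) * (x - k)) / √(c - k)) volume 0 x ∧
      ∫ k in (0:ℝ)..x, √k / √((b - k) * (x - k)) / √(c - k) ≤
        ∫ k in (0:ℝ)..x, 1 / (b - x) * (√k / √(x - k)) := by
  have h1 := intervalIntegrable_sqrt_div_sqrt hx
  have e : ∀ k ∈ Ioc 0 x, 1 / (√(b - k) * √(c - k)) * (√k / √(x - k)) =
      √k / √((b - k) * (x - k)) / √(c - k) := by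
    intro k hk
    rw [Real.sqrt_mul (by linarith [hk.2])]
    simp only [div_eq_mul_inv, mul_inv]
    ring
  have hi : IntervalIntegrable (fun k => √k / √((b - k) * (x - k)) / √(c - k)) volume 0 x := by
    refine (h1.continuousOn_mul (g := fun k => 1 / (√(b - k) * √(c - k))) ?_).congr
      (by rwa [uIoc_of_le hx])
    refine ContinuousOn.div continuousOn_const (by fun_prop) fun k hk => ?_
    rw [uIcc_of_le hx] at hk
    have := Real.sqrt_pos.2 (by linarith [hk.2] : 0 < b - k)
    have := Real.sqrt_pos.2 (by linarith [hk.2] : 0 < c - k)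
    positivity
  refine ⟨hi, ?_⟩
  refine intervalIntegral.integral_mono_on_of_le_Ioo hx hi (h1.const_mul _) fun k hk => ?_
  rw [← e k ⟨hk.1, hk.2.le⟩]
  refine mul_le_mul_of_nonneg_right (one_div_le_one_div_of_le (by linarith) ?_) (by positivity)
  rw [← Real.sqrt_mul (by linarith [hk.2])]
  refine Real.le_sqrt_of_sq_le ?_
  nlinarith [hk.2]

/-- The two Abel-type integrals of a datum on the side `x = 0` differ by a multiple of its
primitive. -/
theorem abel_integral_shift {x y : ℝ} (hx : 0 ≤ x) (hy : 0 ≤ y) (hxy : x + y < 1) {f : ℝ → ℝ}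
    (hf : IntervalIntegrable f volume 0 y) :
    IntervalIntegrable (fun k => √k / √((1 - y - k) * (x - k)) *
        ∫ s in (0:ℝ)..y, f s / √(1 - s - k)) volume 0 x ∧
      ∫ k in (1 - y)..1, √k / √((k - (1 - y)) * (k - x)) *
          ∫ s in (0:ℝ)..(1 - k), f s / √(1 - s - k) =
        Real.pi * (∫ s in (0:ℝ)..y, f s) +
          ∫ k in (0:ℝ)..x, √k / √((1 - y - k) * (x - k)) *
            ∫ s in (0:ℝ)..y, f s / √(1 - s - k) := by
  have hb : x < 1 - y := by linarith
  set w : ℝ → ℝ := fun s => ∫ k in (0:ℝ)..x, √k / √((1 - y - k) * (x - k)) / √(1 - s - k)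
    with hwdef
  set C : ℝ := ∫ k in (0:ℝ)..x, 1 / (1 - y - x) * (√k / √(x - k)) with hC
  have hwC : ∀ s ∈ Ioo 0 y, w s ≤ C := fun s hs =>
    (integral_sqrt_div_sqrt_left_le hx hb (by linarith [hs.2])).2
  obtain ⟨h1, hwf, h2⟩ := kernel_integral_swap
    (K := fun k s => √k / √((1 - y - k) * (x - k)) / √(1 - s - k)) (w := w) hx hy
    (by unfold Function.uncurry; fun_prop) (fun k _ s _ => by positivity)
    (fun s hs => (integral_sqrt_div_sqrt_left_le hx hb (by linarith [hs.2])).1)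
    (fun s hs => rfl) hwC hf
  have hz : ∀ s ∈ Ioo 0 y, ∀ k ∈ Ioc (1 - s) 1,
      √k / √((k - (1 - y)) * (k - x)) / √(1 - s - k) = 0 := by
    intro s hs k hk
    rw [Real.sqrt_eq_zero_of_nonpos (by linarith [hk.1] : 1 - s - k ≤ 0)]; simp
  have hr : ∀ s ∈ Ioo 0 y, _ := fun s hs =>
    integral_sqrt_div_sqrt_right hx hb (by linarith [hs.2] : 1 - y < 1 - s)
  obtain ⟨-, -, h4⟩ := kernel_integral_swap
    (K := fun k s => √k / √((k - (1 - y)) * (k - x)) / √(1 - s - k))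
    (w := fun s => Real.pi + w s) (C := Real.pi + C) (by linarith : 1 - y ≤ 1) hy
    (by unfold Function.uncurry; fun_prop) (fun k _ s _ => by positivity)
    (fun s hs => (hr s hs).1.trans
      (intervalIntegrable_of_zero (by linarith [hs.1]) (hz s hs)))
    (fun s hs => (integral_eq_of_zero_right (by linarith [hs.2]) (by linarith [hs.1])
      (hz s hs)).trans (hr s hs).2)
    (fun s hs => by linarith [hwC s hs]) hf
  have e1 : ∀ k, (∫ s in (0:ℝ)..y, √k / √((1 - y - k) * (x - k)) / √(1 - s - k) * f s) =
      √k / √((1 - y - k) * (x - k)) * ∫ s in (0:ℝ)..y, f s / √(1 - s - k) := by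
    intro k
    rw [← intervalIntegral.integral_const_mul]
    exact intervalIntegral.integral_congr fun s _ => by ring
  have e2 : ∀ k ∈ uIoc (1 - y) 1,
      (∫ s in (0:ℝ)..y, √k / √((k - (1 - y)) * (k - x)) / √(1 - s - k) * f s) =
      √k / √((k - (1 - y)) * (k - x)) * ∫ s in (0:ℝ)..(1 - k), f s / √(1 - s - k) := by
    intro k hk
    rw [uIoc_of_le (by linarith)] at hk
    rw [← intervalIntegral.integral_const_mul,
      integral_eq_of_zero_right (by linarith [hk.2]) (by linarith [hk.1] : 1 - k ≤ y)]
    · exact intervalIntegral.integral_congr fun s _ => by ring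
    · intro s hs
      rw [Real.sqrt_eq_zero_of_nonpos (by linarith [hs.1] : 1 - s - k ≤ 0)]; simp
  simp only [e1] at h1 h2
  refine ⟨h1, ?_⟩
  rw [← intervalIntegral.integral_congr_ae (ae_of_all _ fun k hk => e2 k hk), h4, h2,
    ← intervalIntegral.integral_const_mul, ← intervalIntegral.integral_add (hf.const_mul _) hwf]
  exact intervalIntegral.integral_congr fun s _ => by ring

theorem mem_interior_TriD {x y : ℝ} (hx : 0 < x) (hy : 0 < y) (hxy : x + y < 1) :
    (x, y) ∈ interior TriD := by
  have ho : IsOpen {p : ℝ × ℝ | 0 < p.1 ∧ 0 < p.2 ∧ p.1 + p.2 < 1} :=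
    (isOpen_lt continuous_const continuous_fst).inter
      ((isOpen_lt continuous_const continuous_snd).inter
        (isOpen_lt (continuous_fst.add continuous_snd) continuous_const))
  exact mem_interior.2 ⟨_, fun p hp => ⟨hp.1.le, hp.2.1.le, hp.2.2⟩, ho, hx, hy, hxy⟩

/-- The derivative along lines `y = r` passes to the boundary `y = 0`. -/
theorem hasDerivAt_boundary {W : ℝ → ℝ → ℝ} {G : ℝ × ℝ → ℝ}
    (hW : ContinuousOn (fun p : ℝ × ℝ => W p.1 p.2) TriD)
    (hG : ∀ p ∈ TriD, 0 < p.1 → ContinuousWithinAt G TriD p)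
    (hd : ∀ s r, 0 < s → 0 < r → s + r < 1 → HasDerivAt (fun t => W t r) (G (s, r)) s)
    {s : ℝ} (hs : s ∈ Ioo (0:ℝ) 1) : HasDerivAt (fun t => W t 0) (G (s, 0)) s := by
  rw [hasDerivAt_iff_isLittleO, Asymptotics.isLittleO_iff]
  intro ε hε
  obtain ⟨δ, hδ, hball⟩ := Metric.continuousWithinAt_iff.1
    (hG (s, 0) ⟨hs.1.le, le_rfl, by simpa using hs.2⟩ hs.1) ε hε
  obtain ⟨η, hη, hη1, hη2, hη3⟩ : ∃ η > 0, η ≤ δ ∧ η ≤ s ∧ 2 * η ≤ 1 - s :=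
    ⟨min δ (min s ((1 - s) / 2)), by
      have := hs.1; have := hs.2
      refine lt_min hδ (lt_min hs.1 (by linarith)), min_le_left _ _,
      (min_le_right _ _).trans (min_le_left _ _), by
      have := (min_le_right δ _).trans (min_le_right s ((1 - s) / 2)); linarith⟩
  filter_upwards [Metric.ball_mem_nhds s hη] with u hu
  have hmem : ∀ v ∈ Metric.ball s η, 0 < v ∧ v + η < 1 := by
    intro v hv
    rw [Metric.mem_ball, Real.dist_eq, abs_lt] at hv
    exact ⟨by linarith [hv.1], by linarith [hv.2]⟩
  have hsb : s ∈ Metric.ball s η := Metric.mem_ball_self hη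
  have hlim : ∀ v ∈ Metric.ball s η, Tendsto (fun t => W v t) (𝓝[>] 0) (𝓝 (W v 0)) := by
    intro v hv
    have h0 := hW (v, 0) ⟨(hmem v hv).1.le, le_rfl, by have := (hmem v hv).2; simp; linarith⟩
    refine h0.tendsto.comp (f := fun t : ℝ => (v, t)) (tendsto_nhdsWithin_iff.2 ⟨?_, ?_⟩)
    · exact ((continuous_const.prodMk continuous_id).tendsto 0).mono_left nhdsWithin_le_nhds
    · filter_upwards [Ioo_mem_nhdsGT hη] with t ht
      exact ⟨(hmem v hv).1.le, ht.1.le, by have := (hmem v hv).2; have := ht.2; simp; linarith⟩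
  have hT : Tendsto (fun t => ‖W u t - W s t - (u - s) • G (s, 0)‖) (𝓝[>] 0)
      (𝓝 ‖W u 0 - W s 0 - (u - s) • G (s, 0)‖) :=
    (((hlim u hu).sub (hlim s hsb)).sub_const _).norm
  refine le_of_tendsto hT ?_
  filter_upwards [Ioo_mem_nhdsGT hη] with t ht
  have key := Convex.norm_image_sub_le_of_norm_hasDerivWithin_le (s := Metric.ball s η)
    (f := fun v => W v t - v * G (s, 0)) (f' := fun v => G (v, t) - G (s, 0)) (C := ε)
    (fun v hv => ((hd v t (hmem v hv).1 ht.1 (by linarith [(hmem v hv).2, ht.2])).sub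
      (by simpa using (hasDerivAt_id v).mul_const (G (s, 0)))).hasDerivWithinAt)
    (fun v hv => ?_) (convex_ball s η) hsb hu
  · refine le_of_eq_of_le (congrArg norm ?_) key
    simp only [smul_eq_mul]; ring
  · rw [← dist_eq_norm]
    refine (hball ⟨(hmem v hv).1.le, ht.1.le, ?_⟩ ?_).le
    · have := (hmem v hv).2; have := ht.2; simp; linarith
    · rw [Prod.dist_eq]
      refine max_lt (lt_of_lt_of_le hv hη1) ?_
      simp only [Real.dist_eq, sub_zero, abs_of_pos ht.1]
      linarith [ht.2]

theorem intervalIntegrable_rpow_neg {β : ℝ} (hβ : β < 1) (a b : ℝ) :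
    IntervalIntegrable (fun s : ℝ => s ^ (-β)) volume a b :=
  intervalIntegral.intervalIntegrable_rpow' (by linarith)

theorem mem_TriD_of_le {k y s r : ℝ} (hky : k + y < 1) (hs : 0 ≤ s) (hsk : s ≤ k) (hr : 0 ≤ r)
    (hry : r ≤ y) : (s, r) ∈ TriD :=
  ⟨hs, hr, by simp only; linarith⟩

theorem exists_bound_of_continuousOn_TriD {g : ℝ × ℝ → ℝ} (hg : ContinuousOn g TriD) {k y : ℝ}
    (hky : k + y < 1) :
    ∃ M, 0 ≤ M ∧ ∀ s ∈ Icc 0 k, ∀ r ∈ Icc 0 y, |g (s, r)| ≤ M := by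
  obtain ⟨M, hM⟩ := (isCompact_Icc.prod isCompact_Icc).exists_bound_of_continuousOn
    (f := g) (s := Icc 0 k ×ˢ Icc 0 y)
    (hg.mono fun p hp => mem_TriD_of_le hky hp.1.1 hp.1.2 hp.2.1 hp.2.2)
  exact ⟨max M 0, le_max_right _ _, fun s hs r hr => (hM (s, r) ⟨hs, hr⟩).trans (le_max_left _ _)⟩

theorem continuousOn_rpow_neg_Ioo {β b : ℝ} : ContinuousOn (fun s : ℝ => s ^ (-β)) (Ioo 0 b) :=
  fun _ hs => (Real.continuousAt_rpow_const _ _ (Or.inl hs.1.ne')).continuousWithinAt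

/-- The weighted trace along `y = r` is integrable, with integral the increment of `W`. -/
theorem integral_line {W : ℝ → ℝ → ℝ} {g : ℝ × ℝ → ℝ} {β : ℝ} (hβ : β < 1)
    (hW : ContinuousOn (fun p : ℝ × ℝ => W p.1 p.2) TriD) (hg : ContinuousOn g TriD)
    {b r : ℝ} (hb : 0 ≤ b) (hr : 0 ≤ r) (hbr : b + r < 1)
    (hd : ∀ s ∈ Ioo 0 b, HasDerivAt (fun t => W t r) (g (s, r) * s ^ (-β)) s) :
    IntervalIntegrable (fun s => g (s, r) * s ^ (-β)) volume 0 b ∧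
      ∫ s in (0:ℝ)..b, g (s, r) * s ^ (-β) = W b r - W 0 r := by
  have hline : MapsTo (fun s : ℝ => (s, r)) (Icc 0 b) TriD :=
    fun s hs => mem_TriD_of_le hbr hs.1 hs.2 hr le_rfl
  have hc : ContinuousOn (fun s : ℝ => (s, r)) (Icc 0 b) := by fun_prop
  have hi : IntervalIntegrable (fun s => g (s, r) * s ^ (-β)) volume 0 b :=
    (intervalIntegrable_rpow_neg hβ 0 b).continuousOn_mul
      (by rw [uIcc_of_le hb]; exact hg.comp hc hline)
  exact ⟨hi, intervalIntegral.integral_eq_sub_of_hasDerivAt_of_le hb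
    (hW.comp hc hline) hd hi⟩

/-- Dominated convergence for integrals over exhausting intervals. -/
theorem tendsto_integral_exhaust {H : ℝ → ℝ → ℝ} {H0 bound e : ℝ → ℝ} {b : ℝ} (hb : 0 < b)
    (he : ∀ᶠ t in 𝓝[>] 0, t ≤ e t ∧ e t ≤ b) (he' : Tendsto e (𝓝[>] 0) (𝓝 b))
    (hbound : IntervalIntegrable bound volume 0 b)
    (hc : ∀ᶠ t in 𝓝[>] 0, ContinuousOn (H t) (Ioo 0 b))
    (hH : ∀ᶠ t in 𝓝[>] 0, ∀ s ∈ Ioo t (e t), |H t s| ≤ bound s)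
    (hb0 : ∀ s ∈ Ioo 0 b, 0 ≤ bound s)
    (hlim : ∀ s ∈ Ioo 0 b, Tendsto (fun t => H t s) (𝓝[>] 0) (𝓝 (H0 s))) :
    Tendsto (fun t => ∫ s in t..e t, H t s) (𝓝[>] 0) (𝓝 (∫ s in (0:ℝ)..b, H0 s)) := by
  rw [intervalIntegral.integral_of_le hb.le, integral_Ioc_eq_integral_Ioo]
  have hpos : ∀ᶠ t : ℝ in 𝓝[>] 0, 0 < t := eventually_mem_nhdsWithin
  have key : Tendsto (fun t => ∫ s in Ioo 0 b, (Ioo t (e t)).indicator (H t) s) (𝓝[>] 0)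
      (𝓝 (∫ s in Ioo 0 b, H0 s)) := by
    refine tendsto_integral_filter_of_dominated_convergence bound ?_ ?_
      ((intervalIntegrable_iff_integrableOn_Ioo_of_le hb.le enorm_ne_top enorm_ne_top).1 hbound) ?_
    · filter_upwards [hc] with t ht
      exact (ht.aestronglyMeasurable measurableSet_Ioo).indicator measurableSet_Ioo
    · filter_upwards [hH] with t ht
      filter_upwards [ae_restrict_mem measurableSet_Ioo] with s hs
      by_cases h : s ∈ Ioo t (e t)
      · rw [indicator_of_mem h]; exact ht s h
      · rw [indicator_of_notMem h, norm_zero]; exact hb0 s hs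
    · filter_upwards [ae_restrict_mem measurableSet_Ioo] with s hs
      refine (hlim s hs).congr' ?_
      filter_upwards [he'.eventually_const_lt hs.2, Ioo_mem_nhdsGT hs.1] with t h1 h2
      rw [indicator_of_mem (show s ∈ Ioo t (e t) from ⟨h2.2, h1⟩)]
  refine key.congr' ?_
  filter_upwards [he, hpos] with t ht ht0
  rw [intervalIntegral.integral_of_le ht.1, integral_Ioc_eq_integral_Ioo,
    setIntegral_indicator measurableSet_Ioo,
    inter_eq_self_of_subset_right (Ioo_subset_Ioo ht0.le ht.2)]

theorem intervalIntegrable_rpow_div_sqrt {β k : ℝ} (hβ : β < 1) (hβ0 : 0 ≤ β) (hk : 0 < k) :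
    IntervalIntegrable (fun s => s ^ (-β) / √(k - s)) volume 0 k := by
  have hsq : IntervalIntegrable (fun s : ℝ => (k - s) ^ (-(1 / 2) : ℝ)) volume 0 k := by
    have := (intervalIntegral.intervalIntegrable_rpow' (a := 0) (b := k)
      (by norm_num : (-1:ℝ) < -(1 / 2))).comp_sub_left k enorm_ne_top
    simpa using this.symm
  refine (((intervalIntegrable_rpow_neg hβ 0 k).const_mul (1 / √(k / 2))).add
    (hsq.const_mul ((k / 2) ^ (-β)))).mono_fun (Measurable.aestronglyMeasurable (by fun_prop)) ?_
  rw [uIoc_of_le hk.le]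
  filter_upwards [ae_restrict_mem measurableSet_Ioc] with s hs
  have h0 : 0 ≤ s ^ (-β) := Real.rpow_nonneg hs.1.le _
  have h1 : 0 ≤ (k - s) ^ (-(1 / 2) : ℝ) := Real.rpow_nonneg (by linarith [hs.2]) _
  have h2 : 0 ≤ (k / 2) ^ (-β) := Real.rpow_nonneg (by linarith) _
  have h3 : 0 < √(k / 2) := Real.sqrt_pos.2 (by linarith)
  rw [Real.norm_of_nonneg (by positivity), Real.norm_of_nonneg (by positivity)]
  rcases le_total s (k / 2) with h | h
  · have : s ^ (-β) / √(k - s) ≤ 1 / √(k / 2) * s ^ (-β) := by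
      rw [div_eq_mul_one_div, mul_comm]
      gcongr
      linarith
    linarith [mul_nonneg h2 h1]
  · have e : 1 / √(k - s) = (k - s) ^ (-(1 / 2) : ℝ) := by
      rw [Real.rpow_neg (by linarith [hs.2]), ← Real.sqrt_eq_rpow, one_div]
    have : s ^ (-β) / √(k - s) ≤ (k / 2) ^ (-β) * (k - s) ^ (-(1 / 2) : ℝ) := by
      rw [div_eq_mul_one_div, e]
      exact mul_le_mul_of_nonneg_right
        (Real.rpow_le_rpow_of_nonpos (by linarith) h (by linarith)) h1
    have h4 : 0 ≤ 1 / √(k / 2) * s ^ (-β) := by positivity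
    linarith

theorem hasDerivAt_slices {F : ℝ × ℝ → ℝ} {L : ℝ × ℝ →L[ℝ] ℝ} {s r : ℝ}
    (h : HasFDerivAt F L (s, r)) :
    HasDerivAt (fun t => F (t, r)) (L (1, 0)) s ∧ HasDerivAt (fun t => F (s, t)) (L (0, 1)) r :=
  ⟨h.comp_hasDerivAt s ((hasDerivAt_id s).prodMk (hasDerivAt_const s r)),
    h.comp_hasDerivAt r ((hasDerivAt_const r s).prodMk (hasDerivAt_id r))⟩

/-- First-order partial derivatives of a `C²` function are differentiable, with symmetric mixed
derivative. -/
theorem hasFDerivAt_pdxR_pdyR {V : ℝ → ℝ → ℝ} {U : Set (ℝ × ℝ)} (hU : IsOpen U)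
    (hV : ContDiffOn ℝ 2 (fun p : ℝ × ℝ => V p.1 p.2) U) {p : ℝ × ℝ} (hp : p ∈ U) :
    ∃ L L' : ℝ × ℝ →L[ℝ] ℝ, HasFDerivAt (fun q : ℝ × ℝ => pdxR V q.1 q.2) L p ∧
      HasFDerivAt (fun q : ℝ × ℝ => pdyR V q.1 q.2) L' p ∧
      L (0, 1) = pdxyR V p.1 p.2 ∧ L' (1, 0) = pdxyR V p.1 p.2 := by
  set F : ℝ × ℝ → ℝ := fun p => V p.1 p.2 with hF
  have hsl : ∀ q ∈ U, pdxR V q.1 q.2 = fderiv ℝ F q (1, 0) ∧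
      pdyR V q.1 q.2 = fderiv ℝ F q (0, 1) := by
    intro q hq
    have := hasDerivAt_slices (s := q.1) (r := q.2)
      ((hV.contDiffAt (hU.mem_nhds hq)).differentiableAt (by norm_num)).hasFDerivAt
    exact ⟨this.1.deriv, this.2.deriv⟩
  have hVp := hV.contDiffAt (hU.mem_nhds hp)
  have hd : HasFDerivAt (fderiv ℝ F) (fderiv ℝ (fderiv ℝ F) p) p :=
    ((hVp.fderiv_right (m := 1) (by norm_num)).differentiableAt (by norm_num)).hasFDerivAt
  have hx : HasFDerivAt (fun q : ℝ × ℝ => pdxR V q.1 q.2)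
      ((fderiv ℝ (fderiv ℝ F) p).flip (1, 0)) p := by
    refine HasFDerivAt.congr_of_eventuallyEq (f := fun q => fderiv ℝ F q (1, 0)) ?_ ?_
    · exact (hd.clm_apply (hasFDerivAt_const _ _)).congr_fderiv (by ext <;> simp)
    · filter_upwards [hU.mem_nhds hp] with q hq using (hsl q hq).1
  have hy : HasFDerivAt (fun q : ℝ × ℝ => pdyR V q.1 q.2)
      ((fderiv ℝ (fderiv ℝ F) p).flip (0, 1)) p := by
    refine HasFDerivAt.congr_of_eventuallyEq (f := fun q => fderiv ℝ F q (0, 1)) ?_ ?_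
    · exact (hd.clm_apply (hasFDerivAt_const _ _)).congr_fderiv (by ext <;> simp)
    · filter_upwards [hU.mem_nhds hp] with q hq using (hsl q hq).2
  have hxy : ((fderiv ℝ (fderiv ℝ F) p).flip (0, 1)) (1, 0) = pdxyR V p.1 p.2 :=
    (hasDerivAt_slices (s := p.1) (r := p.2) hy).1.deriv.symm
  refine ⟨_, _, hx, hy, ?_, hxy⟩
  rw [← hxy]
  exact (hVp.isSymmSndFDerivAt (by simp)) (0, 1) (1, 0)

/-- Circulation of the closed one-form attached to the spectral parameter `k`. -/
theorem rectangle_identity {V : ℝ → ℝ → ℝ}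
    (hV : ContDiffOn ℝ 2 (fun p : ℝ × ℝ => V p.1 p.2) (interior TriD))
    (hED : ∀ p ∈ interior TriD, EulerDarbouxAt V p.1 p.2) {a b c d k : ℝ}
    (ha : 0 < a) (hab : a ≤ b) (hbk : b < k) (hc : 0 < c) (hcd : c ≤ d) (hkd : k + d < 1) :
    (∫ s in a..b, √(1 - d - k) / √(k - s) * pdxR V s d) +
        (∫ r in c..d, √(k - b) / √(1 - r - k) * pdyR V b r) =
      (∫ s in a..b, √(1 - c - k) / √(k - s) * pdxR V s c) +
        ∫ r in c..d, √(k - a) / √(1 - r - k) * pdyR V a r := by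
  have hin : ∀ p ∈ Icc a b ×ˢ Icc c d, p ∈ interior TriD := fun p hp =>
    mem_interior_TriD (ha.trans_le hp.1.1) (hc.trans_le hp.2.1) (by linarith [hp.1.2, hp.2.2])
  set f : ℝ × ℝ → ℝ := fun p => √(k - p.1) / √(1 - p.2 - k) * pdyR V p.1 p.2 with hf
  set g : ℝ × ℝ → ℝ := fun p => √(1 - p.2 - k) / √(k - p.1) * pdxR V p.1 p.2 with hg
  have key : ∀ p ∈ Icc a b ×ˢ Icc c d, ∃ A B : ℝ × ℝ →L[ℝ] ℝ,
      HasFDerivAt f A p ∧ HasFDerivAt g B p ∧ A (1, 0) + B (0, 1) = 0 := by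
    rintro ⟨s, r⟩ hp
    obtain ⟨L, L', hL, hL', e, e'⟩ := hasFDerivAt_pdxR_pdyR isOpen_interior hV (hin _ hp)
    have h1 : 0 < k - s := by linarith [hp.1.2]
    have h2 : 0 < 1 - r - k := by linarith [hp.2.2]
    have hn : 0 < 1 - s - r := by linarith
    have h1' := Real.sqrt_pos.2 h1
    have h2' := Real.sqrt_pos.2 h2
    have q1 : √(k - s) ^ 2 = k - s := Real.sq_sqrt h1.le
    have q2 : √(1 - r - k) ^ 2 = 1 - r - k := Real.sq_sqrt h2.le
    have d1 : HasFDerivAt (fun p : ℝ × ℝ => √(k - p.1))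
        ((-1 / (2 * √(k - s))) • ContinuousLinearMap.fst ℝ ℝ ℝ) (s, r) :=
      HasDerivAt.comp_hasFDerivAt (s, r) (h₂ := fun t => √(k - t))
        (((hasDerivAt_id s).const_sub k).sqrt h1.ne') hasFDerivAt_fst
    have d2 : HasFDerivAt (fun p : ℝ × ℝ => √(1 - p.2 - k))
        ((-1 / (2 * √(1 - r - k))) • ContinuousLinearMap.snd ℝ ℝ ℝ) (s, r) :=
      HasDerivAt.comp_hasFDerivAt (s, r) (h₂ := fun t => √(1 - t - k))
        ((((hasDerivAt_id r).const_sub 1).sub_const k).sqrt h2.ne') hasFDerivAt_snd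
    have i1 : HasFDerivAt (fun p : ℝ × ℝ => (√(k - p.1))⁻¹)
        ((-(-1 / (2 * √(k - s))) / √(k - s) ^ 2) • ContinuousLinearMap.fst ℝ ℝ ℝ) (s, r) :=
      HasDerivAt.comp_hasFDerivAt (s, r) (h₂ := fun t => (√(k - t))⁻¹)
        ((((hasDerivAt_id s).const_sub k).sqrt h1.ne').inv h1'.ne') hasFDerivAt_fst
    have i2 : HasFDerivAt (fun p : ℝ × ℝ => (√(1 - p.2 - k))⁻¹)
        ((-(-1 / (2 * √(1 - r - k))) / √(1 - r - k) ^ 2) • ContinuousLinearMap.snd ℝ ℝ ℝ) (s, r) :=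
      HasDerivAt.comp_hasFDerivAt (s, r) (h₂ := fun t => (√(1 - t - k))⁻¹)
        (((((hasDerivAt_id r).const_sub 1).sub_const k).sqrt h2.ne').inv h2'.ne') hasFDerivAt_snd
    refine ⟨_, _, (d1.mul i2).mul hL', (d2.mul i1).mul hL, ?_⟩
    have hED' := hED _ (hin _ hp)
    simp only [EulerDarbouxAt] at hED'
    have hm : pdxyR V s r = (pdxR V s r + pdyR V s r) / (2 * (1 - s - r)) := by linarith
    simp [e, e', hm]
    field_simp
    rw [q1, q2]
    ring
  have hcf : ContinuousOn f (Icc a b ×ˢ Icc c d) := fun p hp => by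
    obtain ⟨A, B, h, -, -⟩ := key p hp
    exact h.continuousAt.continuousWithinAt
  have hcg : ContinuousOn g (Icc a b ×ˢ Icc c d) := fun p hp => by
    obtain ⟨A, B, -, h, -⟩ := key p hp
    exact h.continuousAt.continuousWithinAt
  have hzero : ∀ p ∈ Icc a b ×ˢ Icc c d,
      fderiv ℝ f p (1, 0) + fderiv ℝ g p (0, 1) = 0 := fun p hp => by
    obtain ⟨A, B, h, h', e⟩ := key p hp
    rw [h.fderiv, h'.fderiv, e]
  have hsub : Ioo a b ×ˢ Ioo c d ⊆ Icc a b ×ˢ Icc c d :=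
    prod_mono Ioo_subset_Icc_self Ioo_subset_Icc_self
  have G := integral2_divergence_prod_of_hasFDerivAt_off_countable f g (fderiv ℝ f) (fderiv ℝ g)
    a c b d ∅ countable_empty (by simpa [uIcc_of_le, hab, hcd] using hcf)
    (by simpa [uIcc_of_le, hab, hcd] using hcg)
    (fun p hp => by
      rw [min_eq_left hab, max_eq_right hab, min_eq_left hcd, max_eq_right hcd] at hp
      obtain ⟨A, B, h, -, -⟩ := key p (hsub hp.1)
      exact h.differentiableAt.hasFDerivAt)
    (fun p hp => by
      rw [min_eq_left hab, max_eq_right hab, min_eq_left hcd, max_eq_right hcd] at hp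
      obtain ⟨A, B, -, h, -⟩ := key p (hsub hp.1)
      exact h.differentiableAt.hasFDerivAt)
    (by
      rw [uIcc_of_le hab, uIcc_of_le hcd]
      exact integrableOn_zero.congr_fun (fun p hp => (hzero p hp).symm)
        (measurableSet_Icc.prod measurableSet_Icc))
  have hz : ∫ s in a..b, ∫ r in c..d, fderiv ℝ f (s, r) (1, 0) + fderiv ℝ g (s, r) (0, 1) = 0 := by
    rw [intervalIntegral.integral_congr (g := fun _ => (0:ℝ)), intervalIntegral.integral_zero]
    intro s hs
    simp only
    rw [intervalIntegral.integral_congr (g := fun _ => (0:ℝ)), intervalIntegral.integral_zero]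
    intro r hr
    rw [uIcc_of_le hab] at hs
    rw [uIcc_of_le hcd] at hr
    exact hzero (s, r) ⟨hs, hr⟩
  rw [hz] at G
  simp only [hf, hg] at G
  linarith

theorem tendsto_of_continuousOn_TriD {g : ℝ × ℝ → ℝ} (hg : ContinuousOn g TriD) {γ : ℝ → ℝ × ℝ}
    (hγ : Continuous γ) (h0 : γ 0 ∈ TriD) (h : ∀ᶠ t in 𝓝[>] 0, γ t ∈ TriD) :
    Tendsto (fun t => g (γ t)) (𝓝[>] 0) (𝓝 (g (γ 0))) :=
  (hg _ h0).tendsto.comp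
    (tendsto_nhdsWithin_iff.2 ⟨(hγ.tendsto 0).mono_left nhdsWithin_le_nhds, h⟩)

/-- For a solution of the Euler–Darboux equation, the half-order integral of `V_x` along a
horizontal line is determined by the boundary traces. -/
theorem half_integral_identity {V : ℝ → ℝ → ℝ} {β : ℝ} (hβ0 : 0 ≤ β) (hβ : β < 1)
    (hV : ContDiffOn ℝ 2 (fun p : ℝ × ℝ => V p.1 p.2) (interior TriD))
    (hED : ∀ p ∈ interior TriD, EulerDarbouxAt V p.1 p.2) {g₁ g₂ : ℝ × ℝ → ℝ}
    (hg₁ : ContinuousOn g₁ TriD) (hg₂ : ContinuousOn g₂ TriD)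
    (h₁ : ∀ s r, 0 < s → 0 < r → s + r < 1 → pdxR V s r = g₁ (s, r) * s ^ (-β))
    (h₂ : ∀ s r, 0 < s → 0 < r → s + r < 1 → pdyR V s r = g₂ (s, r) * r ^ (-β))
    {k y : ℝ} (hk : 0 < k) (hy : 0 < y) (hky : k + y < 1) :
    √(1 - y - k) * (∫ s in (0:ℝ)..k, g₁ (s, y) * s ^ (-β) / √(k - s)) =
      √(1 - k) * (∫ s in (0:ℝ)..k, g₁ (s, 0) * s ^ (-β) / √(k - s)) +
        √k * ∫ r in (0:ℝ)..y, g₂ (0, r) * r ^ (-β) / √(1 - r - k) := by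
  obtain ⟨M₁, hM₁, hb₁⟩ := exists_bound_of_continuousOn_TriD hg₁ hky
  obtain ⟨M₂, hM₂, hb₂⟩ := exists_bound_of_continuousOn_TriD hg₂ hky
  have hsmall : ∀ᶠ t : ℝ in 𝓝[>] 0, 0 < t ∧ 2 * t < k ∧ t < y := by
    filter_upwards [Ioo_mem_nhdsGT (show (0:ℝ) < min (k / 2) y from lt_min (by linarith) hy)]
      with t ht
    have := lt_min_iff.1 ht.2
    exact ⟨ht.1, by linarith, this.2⟩
  have hkt : Tendsto (fun t : ℝ => k - t) (𝓝[>] 0) (𝓝 k) := by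
    have : Tendsto (fun t : ℝ => k - t) (𝓝 0) (𝓝 (k - 0)) :=
      Continuous.tendsto (by fun_prop) 0
    rw [sub_zero] at this
    exact this.mono_left nhdsWithin_le_nhds
  have hdpos : 0 < √(1 - y - k) := Real.sqrt_pos.2 (by linarith)
  -- horizontal edges
  have hor : ∀ ρ : ℝ → ℝ, Continuous ρ → (∀ᶠ t in 𝓝[>] 0, 0 ≤ ρ t ∧ ρ t ≤ y) → 0 ≤ ρ 0 →
      ρ 0 ≤ y → Tendsto (fun t => ∫ s in t..(k - t),
        √(1 - ρ t - k) / √(k - s) * (g₁ (s, ρ t) * s ^ (-β))) (𝓝[>] 0)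
        (𝓝 (∫ s in (0:ℝ)..k, √(1 - ρ 0 - k) / √(k - s) * (g₁ (s, ρ 0) * s ^ (-β)))) := by
    intro ρ hρ hρy h0 h0y
    refine tendsto_integral_exhaust (bound := fun s => M₁ * (s ^ (-β) / √(k - s))) hk ?_ hkt
      ((intervalIntegrable_rpow_div_sqrt hβ hβ0 hk).const_mul _) ?_ ?_ ?_ ?_
    · filter_upwards [hsmall] with t ht
      exact ⟨by linarith, by linarith⟩
    · filter_upwards [hρy] with t ht
      refine ContinuousOn.mul (ContinuousOn.div continuousOn_const (by fun_prop) fun s hs => ?_)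
        (ContinuousOn.mul ?_ continuousOn_rpow_neg_Ioo)
      · exact (Real.sqrt_pos.2 (by linarith [hs.2])).ne'
      · exact hg₁.comp (by fun_prop) fun s hs => mem_TriD_of_le hky hs.1.le hs.2.le ht.1 ht.2
    · filter_upwards [hsmall, hρy] with t ht ht' s hs
      have hs0 : 0 < s := by linarith [hs.1]
      have hsk : s < k := by linarith [hs.2]
      have hr : 0 ≤ s ^ (-β) := Real.rpow_nonneg hs0.le _
      have hq : √(1 - ρ t - k) ≤ 1 := Real.sqrt_le_one.2 (by linarith [ht'.1])
      rw [abs_mul, abs_mul, abs_of_nonneg hr, abs_of_nonneg (by positivity)]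
      calc √(1 - ρ t - k) / √(k - s) * (|g₁ (s, ρ t)| * s ^ (-β))
          ≤ 1 / √(k - s) * (M₁ * s ^ (-β)) := by
            gcongr
            exact hb₁ s ⟨hs0.le, hsk.le⟩ _ ht'
        _ = M₁ * (s ^ (-β) / √(k - s)) := by ring
    · intro s hs
      have hr : 0 ≤ s ^ (-β) := Real.rpow_nonneg hs.1.le _
      positivity
    · intro s hs
      refine Tendsto.mul ?_ (Tendsto.mul_const _ ?_)
      · exact (Continuous.tendsto (f := fun t => √(1 - ρ t - k) / √(k - s)) (by fun_prop)
          0).mono_left nhdsWithin_le_nhds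
      · refine tendsto_of_continuousOn_TriD hg₁ (γ := fun t => (s, ρ t)) (by fun_prop)
          (mem_TriD_of_le hky hs.1.le hs.2.le h0 h0y) ?_
        filter_upwards [hρy] with t ht using mem_TriD_of_le hky hs.1.le hs.2.le ht.1 ht.2
  -- vertical edges
  have ver : ∀ σ : ℝ → ℝ, Continuous σ → (∀ᶠ t in 𝓝[>] 0, 0 ≤ σ t ∧ σ t ≤ k) → 0 ≤ σ 0 →
      σ 0 ≤ k → Tendsto (fun t => ∫ r in t..y,
        √(k - σ t) / √(1 - r - k) * (g₂ (σ t, r) * r ^ (-β))) (𝓝[>] 0)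
        (𝓝 (∫ r in (0:ℝ)..y, √(k - σ 0) / √(1 - r - k) * (g₂ (σ 0, r) * r ^ (-β)))) := by
    intro σ hσ hσk h0 h0k
    refine tendsto_integral_exhaust (e := fun _ => y)
      (bound := fun r => 1 / √(1 - y - k) * M₂ * r ^ (-β)) hy ?_ tendsto_const_nhds
      ((intervalIntegrable_rpow_neg hβ 0 y).const_mul _) ?_ ?_ ?_ ?_
    · filter_upwards [hsmall] with t ht
      exact ⟨by linarith, le_rfl⟩
    · filter_upwards [hσk] with t ht
      refine ContinuousOn.mul (ContinuousOn.div continuousOn_const (by fun_prop) fun r hr => ?_)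
        (ContinuousOn.mul ?_ continuousOn_rpow_neg_Ioo)
      · exact (Real.sqrt_pos.2 (by linarith [hr.2])).ne'
      · exact hg₂.comp (by fun_prop) fun r hr => mem_TriD_of_le hky ht.1 ht.2 hr.1.le hr.2.le
    · filter_upwards [hsmall, hσk] with t ht ht' r hr
      have hr0 : 0 < r := by linarith [hr.1]
      have hry : r < y := hr.2
      have hp : 0 ≤ r ^ (-β) := Real.rpow_nonneg hr0.le _
      have hq : √(k - σ t) ≤ 1 := Real.sqrt_le_one.2 (by linarith [ht'.1])
      rw [abs_mul, abs_mul, abs_of_nonneg hp, abs_of_nonneg (by positivity), mul_assoc]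
      gcongr
      exact hb₂ _ ht' r ⟨hr0.le, hry.le⟩
    · intro r hr
      have hp : 0 ≤ r ^ (-β) := Real.rpow_nonneg hr.1.le _
      positivity
    · intro r hr
      refine Tendsto.mul ?_ (Tendsto.mul_const _ ?_)
      · exact (Continuous.tendsto (f := fun t => √(k - σ t) / √(1 - r - k)) (by fun_prop)
          0).mono_left nhdsWithin_le_nhds
      · refine tendsto_of_continuousOn_TriD hg₂ (γ := fun t => (σ t, r)) (by fun_prop)
          (mem_TriD_of_le hky h0 h0k hr.1.le hr.2.le) ?_
        filter_upwards [hσk] with t ht using mem_TriD_of_le hky ht.1 ht.2 hr.1.le hr.2.le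
  have T1 := hor (fun _ => y) continuous_const (Eventually.of_forall fun _ => ⟨hy.le, le_rfl⟩)
    hy.le le_rfl
  have T2 := hor (fun t => t) continuous_id
    (by filter_upwards [hsmall] with t ht; exact ⟨ht.1.le, ht.2.2.le⟩) le_rfl hy.le
  have T3 := ver (fun t => k - t) (by fun_prop)
    (by filter_upwards [hsmall] with t ht; exact ⟨by linarith, by linarith⟩)
    (by linarith) (by linarith)
  have T4 := ver (fun t => t) continuous_id
    (by filter_upwards [hsmall] with t ht; exact ⟨by linarith, by linarith⟩) le_rfl hk.le
  have lim := tendsto_nhds_unique_of_eventuallyEq (T1.add T3) (T2.add T4) (by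
    filter_upwards [hsmall] with t ht
    have R := rectangle_identity hV hED (a := t) (b := k - t) (c := t) (d := y) (k := k) ht.1
      (by linarith) (by linarith) ht.1 ht.2.2.le hky
    have hs : ∀ r ∈ Ioc 0 y, ∫ s in t..(k - t), √(1 - r - k) / √(k - s) * pdxR V s r =
        ∫ s in t..(k - t), √(1 - r - k) / √(k - s) * (g₁ (s, r) * s ^ (-β)) := by
      intro r hr
      refine intervalIntegral.integral_congr fun s hs => ?_
      rw [uIcc_of_le (by linarith)] at hs
      simp only [h₁ s r (by linarith [hs.1]) hr.1 (by linarith [hs.2, hr.2])]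
    have hr : ∀ s ∈ Ioc 0 k, ∫ r in t..y, √(k - s) / √(1 - r - k) * pdyR V s r =
        ∫ r in t..y, √(k - s) / √(1 - r - k) * (g₂ (s, r) * r ^ (-β)) := by
      intro s hs
      refine intervalIntegral.integral_congr fun r hr => ?_
      rw [uIcc_of_le ht.2.2.le] at hr
      simp only [h₂ s r hs.1 (by linarith [hr.1]) (by linarith [hs.2, hr.2])]
    rwa [hs y ⟨hy, le_rfl⟩, hs t ⟨ht.1, ht.2.2.le⟩, hr t ⟨ht.1, by linarith⟩,
      hr (k - t) ⟨by linarith, by linarith⟩] at R)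
  simp only [sub_zero, sub_self, Real.sqrt_zero, zero_div, zero_mul,
    intervalIntegral.integral_zero, add_zero] at lim
  simp only [← intervalIntegral.integral_const_mul]
  calc _ = ∫ s in (0:ℝ)..k, √(1 - y - k) / √(k - s) * (g₁ (s, y) * s ^ (-β)) :=
        intervalIntegral.integral_congr fun s _ => by ring
    _ = _ := lim
    _ = _ := congrArg₂ (· + ·) (intervalIntegral.integral_congr fun s _ => by ring)
        (intervalIntegral.integral_congr fun s _ => by ring)

/-- The Abel-type integral representation of the solution of the
Goursat problem for the Euler–Darboux equation. -/
theorem eulerDarboux_goursat_abel_representation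
    (n : ℕ) (hn : 2 ≤ n) (α : ℝ) (hα : α ∈ Ico (0:ℝ) 1)
    (V0 V1 : ℝ → ℝ) (hd0 : EDData n α V0) (hd1 : EDData n α V1)
    (V : ℝ → ℝ → ℝ) (hV : EDSolution n V V0 V1)
    (x y : ℝ) (hxy : (x, y) ∈ TriD) :
    V x y =
      (1 / Real.pi) * (∫ k in (0:ℝ)..x,
        Real.sqrt (1 - k) / Real.sqrt ((1 - y - k) * (x - k)) *
          ∫ x' in (0:ℝ)..k, deriv V0 x' / Real.sqrt (k - x')) +
      (1 / Real.pi) * (∫ k in (1 - y : ℝ)..1,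
        Real.sqrt k / Real.sqrt ((k - (1 - y)) * (k - x)) *
          ∫ y' in (0:ℝ)..(1 - k), deriv V1 y' / Real.sqrt (1 - y' - k)) := by
  obtain ⟨β, ⟨hβ0, hβ⟩, hc, hC, hED, ⟨g₁, hg₁, hg₁'⟩, ⟨g₂, hg₂, hg₂'⟩, -, hV0, hV1⟩ := hV
  obtain ⟨hx, hy, hxy⟩ := hxy
  simp only at hx hy hxy
  have hC2 : ContDiffOn ℝ 2 (fun p : ℝ × ℝ => V p.1 p.2) (interior TriD) :=
    hC.of_le (by exact_mod_cast hn)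
  have hcancel : ∀ s : ℝ, 0 < s → ∀ v : ℝ, v = s ^ β * v * s ^ (-β) := by
    intro s hs v
    rw [Real.rpow_neg hs.le]
    have := Real.rpow_pos_of_pos hs β
    field_simp
  have h₁ : ∀ s r, 0 < s → 0 < r → s + r < 1 → pdxR V s r = g₁ (s, r) * s ^ (-β) := by
    intro s r hs hr hsr
    rw [hg₁' _ (mem_interior_TriD hs hr hsr)]
    exact hcancel s hs _
  have h₂ : ∀ s r, 0 < s → 0 < r → s + r < 1 → pdyR V s r = g₂ (s, r) * r ^ (-β) := by
    intro s r hs hr hsr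
    rw [hg₂' _ (mem_interior_TriD hs hr hsr)]
    exact hcancel r hr _
  have hdV : ∀ s r, 0 < s → 0 < r → s + r < 1 →
      DifferentiableAt ℝ (fun p : ℝ × ℝ => V p.1 p.2) (s, r) := fun s r hs hr hsr =>
    (hC2.contDiffAt (isOpen_interior.mem_nhds (mem_interior_TriD hs hr hsr))).differentiableAt
      (by norm_num)
  have hd₁ : ∀ s r, 0 < s → 0 < r → s + r < 1 →
      HasDerivAt (fun t => V t r) (g₁ (s, r) * s ^ (-β)) s := by
    intro s r hs hr hsr
    rw [← h₁ s r hs hr hsr]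
    exact (hasDerivAt_slices (hdV s r hs hr hsr).hasFDerivAt).1.differentiableAt.hasDerivAt
  have hd₂ : ∀ s r, 0 < s → 0 < r → s + r < 1 →
      HasDerivAt (fun t => V r t) (g₂ (r, s) * s ^ (-β)) s := by
    intro s r hs hr hsr
    rw [← h₂ r s hr hs (by linarith)]
    exact (hasDerivAt_slices (hdV r s hr hs (by linarith)).hasFDerivAt).2.differentiableAt.hasDerivAt
  have hswap : MapsTo Prod.swap TriD TriD := fun p hp => ⟨hp.2.1, hp.1, by
    have := hp.2.2
    simp only [Prod.fst_swap, Prod.snd_swap]; linarith⟩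
  have hc' : ContinuousOn (fun p : ℝ × ℝ => V p.2 p.1) TriD :=
    hc.comp continuous_swap.continuousOn hswap
  have hg₂s : ContinuousOn (fun p : ℝ × ℝ => g₂ (p.2, p.1)) TriD :=
    hg₂.comp continuous_swap.continuousOn hswap
  have hpow : ∀ p : ℝ × ℝ, 0 < p.1 → ContinuousWithinAt (fun p : ℝ × ℝ => p.1 ^ (-β)) TriD p :=
    fun p hp => ((Real.continuousAt_rpow_const p.1 (-β) (Or.inl hp.ne')).comp
      continuousAt_fst).continuousWithinAt
  have hb₁ : ∀ s ∈ Ioo (0:ℝ) 1, HasDerivAt (fun t => V t 0) (g₁ (s, 0) * s ^ (-β)) s := fun s hs =>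
    hasDerivAt_boundary (G := fun p => g₁ p * p.1 ^ (-β)) hc
      (fun p hp hp0 => (hg₁ p hp).mul (hpow p hp0)) hd₁ hs
  have hb₂ : ∀ s ∈ Ioo (0:ℝ) 1, HasDerivAt (fun t => V 0 t) (g₂ (0, s) * s ^ (-β)) s := fun s hs =>
    hasDerivAt_boundary (W := fun a b => V b a) (G := fun p => g₂ (p.2, p.1) * p.1 ^ (-β)) hc'
      (fun p hp hp0 => (hg₂s p hp).mul (hpow p hp0)) hd₂ hs
  have hD0 : ∀ s ∈ Ioo (0:ℝ) 1, deriv V0 s = g₁ (s, 0) * s ^ (-β) := fun s hs =>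
    ((hb₁ s hs).congr_of_eventuallyEq (by
      filter_upwards [Ioo_mem_nhds hs.1 hs.2] with t ht using (hV0 t ⟨ht.1.le, ht.2⟩).symm)).deriv
  have hD1 : ∀ s ∈ Ioo (0:ℝ) 1, deriv V1 s = g₂ (0, s) * s ^ (-β) := fun s hs =>
    ((hb₂ s hs).congr_of_eventuallyEq (by
      filter_upwards [Ioo_mem_nhds hs.1 hs.2] with t ht using (hV1 t ⟨ht.1.le, ht.2⟩).symm)).deriv
  have hI0 : ∀ b ∈ Ico (0:ℝ) 1, IntervalIntegrable (deriv V0) volume 0 b ∧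
      ∫ s in (0:ℝ)..b, deriv V0 s = V b 0 - V 0 0 := by
    intro b hb
    obtain ⟨i1, i2⟩ := integral_line (W := V) (r := 0) hβ hc hg₁ hb.1 le_rfl
      (by simpa using hb.2) fun s hs => hb₁ s ⟨hs.1, hs.2.trans hb.2⟩
    have e : ∀ s ∈ uIoc 0 b, deriv V0 s = g₁ (s, 0) * s ^ (-β) := by
      intro s hs
      rw [uIoc_of_le hb.1] at hs
      exact hD0 s ⟨hs.1, hs.2.trans_lt hb.2⟩
    exact ⟨i1.congr fun s hs => (e s hs).symm,
      (intervalIntegral.integral_congr_ae (ae_of_all _ e)).trans i2⟩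
  have hI1 : ∀ b ∈ Ico (0:ℝ) 1, IntervalIntegrable (deriv V1) volume 0 b ∧
      ∫ s in (0:ℝ)..b, deriv V1 s = V 0 b - V 0 0 := by
    intro b hb
    obtain ⟨i1, i2⟩ := integral_line (W := fun a b => V b a) (g := fun p => g₂ (p.2, p.1))
      (r := 0) hβ hc' hg₂s hb.1 le_rfl
      (by simpa using hb.2) fun s hs => hb₂ s ⟨hs.1, hs.2.trans hb.2⟩
    have e : ∀ s ∈ uIoc 0 b, deriv V1 s = g₂ (0, s) * s ^ (-β) := by
      intro s hs
      rw [uIoc_of_le hb.1] at hs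
      exact hD1 s ⟨hs.1, hs.2.trans_lt hb.2⟩
    exact ⟨i1.congr fun s hs => (e s hs).symm,
      (intervalIntegral.integral_congr_ae (ae_of_all _ e)).trans i2⟩
  have h00 : V 0 0 = 0 := (hV0 0 ⟨le_rfl, one_pos⟩).trans hd0.2.2.2
  have hpi := Real.pi_pos
  rcases hy.eq_or_lt with rfl | hy0
  · obtain ⟨i1, i2⟩ := hI0 x ⟨hx, by linarith⟩
    have A := (abel_integral hx i1).2
    rw [i2, h00, sub_zero] at A
    have e : ∫ k in (0:ℝ)..x, √(1 - k) / √((1 - 0 - k) * (x - k)) *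
          ∫ x' in (0:ℝ)..k, deriv V0 x' / √(k - x') =
        ∫ k in (0:ℝ)..x, 1 / √(x - k) * ∫ x' in (0:ℝ)..k, deriv V0 x' / √(k - x') := by
      refine intervalIntegral.integral_congr fun k hk => ?_
      rw [uIcc_of_le hx] at hk
      have h1 : 0 < 1 - k := by linarith [hk.2]
      have h1' := Real.sqrt_pos.2 h1
      simp only [sub_zero, Real.sqrt_mul h1.le]
      congr 1
      field_simp
    rw [e, A]
    simp only [sub_zero, intervalIntegral.integral_same, mul_zero, add_zero]
    field_simp
  · obtain ⟨j1, j2⟩ := hI1 y ⟨hy, by linarith⟩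
    rw [h00, sub_zero] at j2
    obtain ⟨b1, b2⟩ := abel_integral_shift hx hy hxy j1
    obtain ⟨i1, i2⟩ := integral_line (W := V) (r := y) hβ hc hg₁ hx hy hxy
      fun s hs => hd₁ s y hs.1 hy0 (by linarith [hs.2])
    obtain ⟨a1, a2⟩ := abel_integral hx i1
    have e : ∀ k ∈ uIoc 0 x,
        1 / √(x - k) * (∫ s in (0:ℝ)..k, g₁ (s, y) * s ^ (-β) / √(k - s)) =
          √(1 - k) / √((1 - y - k) * (x - k)) * (∫ x' in (0:ℝ)..k, deriv V0 x' / √(k - x')) +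
          √k / √((1 - y - k) * (x - k)) * ∫ s in (0:ℝ)..y, deriv V1 s / √(1 - s - k) := by
      intro k hk
      rw [uIoc_of_le hx] at hk
      have H := half_integral_identity hβ0 hβ hC2 hED hg₁ hg₂ h₁ h₂ hk.1 hy0 (by linarith [hk.2])
      have e0 : ∫ x' in (0:ℝ)..k, deriv V0 x' / √(k - x') =
          ∫ s in (0:ℝ)..k, g₁ (s, 0) * s ^ (-β) / √(k - s) := by
        refine intervalIntegral.integral_congr_ae (ae_of_all _ fun s hs => ?_)
        rw [uIoc_of_le hk.1.le] at hs
        rw [hD0 s ⟨hs.1, by linarith [hs.2, hk.2]⟩]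
      have e1 : ∫ s in (0:ℝ)..y, deriv V1 s / √(1 - s - k) =
          ∫ s in (0:ℝ)..y, g₂ (0, s) * s ^ (-β) / √(1 - s - k) := by
        refine intervalIntegral.integral_congr_ae (ae_of_all _ fun s hs => ?_)
        rw [uIoc_of_le hy] at hs
        rw [hD1 s ⟨hs.1, by linarith [hs.2]⟩]
      have hp : 0 < 1 - y - k := by linarith [hk.2]
      have hp' := Real.sqrt_pos.2 hp
      rw [e0, e1, Real.sqrt_mul hp.le]
      generalize (∫ s in (0:ℝ)..k, g₁ (s, y) * s ^ (-β) / √(k - s)) = A at *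
      generalize (∫ s in (0:ℝ)..k, g₁ (s, 0) * s ^ (-β) / √(k - s)) = B at *
      generalize (∫ s in (0:ℝ)..y, g₂ (0, s) * s ^ (-β) / √(1 - s - k)) = C at *
      have hA : A = (√(1 - k) * B + √k * C) / √(1 - y - k) := by
        rw [← H]; field_simp
      rw [hA]
      simp only [div_eq_mul_inv, mul_inv]
      ring
    have a3 : IntervalIntegrable (fun k => √(1 - k) / √((1 - y - k) * (x - k)) *
        ∫ x' in (0:ℝ)..k, deriv V0 x' / √(k - x')) volume 0 x := by
      refine (a1.sub b1).congr fun k hk => ?_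
      simp only [e k hk, add_sub_cancel_right]
    rw [intervalIntegral.integral_congr_ae (ae_of_all _ e), intervalIntegral.integral_add a3 b1,
      i2] at a2
    rw [b2, j2, ← mul_add, ← sub_eq_iff_eq_add.2 (a2.symm.trans (add_comm _ _))]
    field_simp
    ring
end
end
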